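/- arXiv:2409.20321 — 2 statements merged into one kernel-verified Lean document; each statement's English description precedes it below -/
import Mathlib

section
/- Let p, q ∈ C¹([0,ℓ];ℝ), a ∈ C²([0,ℓ];ℝ) with a > 0 on [0,ℓ], and let K ∈ C²(closure Ω;ℝ) solve the Goursat problem associated with (a,p,q). Let b(x) = x·b̃(x), where b̃ ∈ C²([0,ℓ];ℂ) and there are constants κ > 0 and r ∈ (0,ℓ] with |b̃(x)| ≥ κ for 0 ≤ x ≤ r. If ∫₀ˣ K(x,y) b(y) dy = 0 for all x ∈ [0,ℓ], then there exists ε ∈ (0,ℓ) such that p(x) = q(x) for all x ∈ [0,ε]. -/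
open Set MeasureTheory intervalIntegral

noncomputable section

/-- `K` solves the Goursat problem associated with `(a, p, q)` on the closed
triangle `{0 ≤ y ≤ x ≤ ℓ}` (closure of `Ω = {0 < y < x < ℓ}`): it is `C²` on
the closed triangle, satisfies the hyperbolic equation
`a(x)∂ₓ²K − ∂_y²(a(y)K) = (q(x) − p(y))K` in `Ω`, the boundary condition
`a(0)∂_yK(x,0) + a'(0)K(x,0) = 0`, the diagonal condition
`2a(x)(d/dx)K(x,x) + a'(x)K(x,x) = q(x) − p(x)` for `0 < x < ℓ`, and `K(0,0)=0`. -/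
def IsGoursatSol (ℓ : ℝ) (a p q : ℝ → ℝ) (K : ℝ → ℝ → ℝ) : Prop :=
  ContDiffOn ℝ 2 (fun z : ℝ × ℝ => K z.1 z.2)
      {z : ℝ × ℝ | 0 ≤ z.2 ∧ z.2 ≤ z.1 ∧ z.1 ≤ ℓ} ∧
  (∀ x y : ℝ, 0 < y → y < x → x < ℓ →
      a x * deriv (fun s => deriv (fun s' => K s' y) s) x
        - deriv (fun s => deriv (fun s' => a s' * K x s') s) y
        = (q x - p y) * K x y) ∧
  (∀ x : ℝ, 0 < x → x < ℓ →
      a 0 * derivWithin (fun s => K x s) (Icc 0 x) 0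
        + derivWithin a (Icc 0 ℓ) 0 * K x 0 = 0) ∧
  (∀ x : ℝ, 0 < x → x < ℓ →
      2 * a x * derivWithin (fun s => K s s) (Icc 0 ℓ) x
        + derivWithin a (Icc 0 ℓ) x * K x x = q x - p x) ∧
  K 0 0 = 0



open Topology Filter

/-- Leibniz rule on the line: differentiation of `∫₀ˣ G(x,y) dy`. -/
theorem hasDerivAt_integral_zero_self {G G' : ℝ → ℝ → ℂ}
    (hG : Continuous (Function.uncurry G)) (hG' : Continuous (Function.uncurry G'))
    (hd : ∀ x y, HasDerivAt (fun s => G s y) (G' x y) x) (x : ℝ) :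
    HasDerivAt (fun x => ∫ y in (0:ℝ)..x, G x y) (G x x + ∫ y in (0:ℝ)..x, G' x y) x := by
  let f : ℝ → ℝ → ℂ := fun v u => ∫ y in (0:ℝ)..u, G v y
  let f₁ : ℝ → ℝ → ℝ →L[ℝ] ℂ := fun v u =>
    ContinuousLinearMap.toSpanSingleton ℝ (∫ y in (0:ℝ)..u, G' v y)
  let f₂ : ℝ → ℝ → ℝ →L[ℝ] ℂ := fun v u => ContinuousLinearMap.toSpanSingleton ℝ (G v u)
  have h1 : ∀ v u, HasFDerivAt (fun v => f v u) (f₁ v u) v := by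
    intro v u
    have : HasDerivAt (fun v => f v u) (∫ y in (0:ℝ)..u, G' v y) v := by
      have hK : IsCompact (Metric.closedBall v 1 ×ˢ uIcc 0 u) :=
        (isCompact_closedBall v 1).prod isCompact_uIcc
      obtain ⟨C, hC⟩ := hK.exists_bound_of_continuousOn hG'.continuousOn
      refine (intervalIntegral.hasDerivAt_integral_of_dominated_loc_of_deriv_le
        (bound := fun _ => C)
        (Metric.closedBall_mem_nhds v one_pos) ?_ ?_ ?_ ?_ ?_ ?_).2
      · exact Eventually.of_forall fun s =>
          (hG.comp (by fun_prop : Continuous fun y => (s, y))).aestronglyMeasurable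
      · exact (hG.comp (by fun_prop : Continuous fun y => (v, y))).intervalIntegrable _ _
      · exact (hG'.comp (by fun_prop : Continuous fun y => (v, y))).aestronglyMeasurable
      · exact Eventually.of_forall fun y hy s hs => hC (s, y) ⟨hs, uIoc_subset_uIcc hy⟩
      · exact _root_.intervalIntegrable_const
      · exact Eventually.of_forall fun y _ s _ => hd s y
    exact this.hasFDerivAt
  have h2 : ∀ v u, HasFDerivAt (fun u => f v u) (f₂ v u) u := by
    intro v u
    have hc : Continuous fun y => G v y := hG.comp (by fun_prop : Continuous fun y => (v, y))
    exact (hc.integral_hasStrictDerivAt 0 u).hasDerivAt.hasFDerivAt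
  have c1 : Continuous (Function.uncurry f₁) := by
    have : Continuous fun z : ℝ × ℝ => ∫ y in (0:ℝ)..z.2, G' z.1 y :=
      continuous_parametric_intervalIntegral_of_continuous
        (f := fun (z : ℝ × ℝ) y => G' z.1 y)
        (hG'.comp (by fun_prop : Continuous fun w : (ℝ × ℝ) × ℝ => (w.1.1, w.2)))
        continuous_snd
    exact (ContinuousLinearMap.toSpanSingletonCLE (𝕜 := ℝ) (E := ℂ)).continuous.comp this
  have c2 : Continuous (Function.uncurry f₂) :=
    (ContinuousLinearMap.toSpanSingletonCLE (𝕜 := ℝ) (E := ℂ)).continuous.comp hG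
  have key := (hasStrictFDerivAt_uncurry_coprod (u := (x, x)) (f := f) (f₁ := f₁) (f₂ := f₂)
    (Eventually.of_forall fun v => h1 v.1 v.2) (Eventually.of_forall fun v => h2 v.1 v.2)
    c1.continuousAt c2.continuousAt).hasFDerivAt
  have := HasFDerivAt.comp_hasDerivAt (f := fun s : ℝ => (s, s)) x key
    ((hasDerivAt_id x).prodMk (hasDerivAt_id x))
  convert! this using 1
  simp [f₁, f₂, add_comm, Function.HasUncurry.uncurry]

/-- The closed triangle `{0 ≤ y ≤ x ≤ ℓ}`. -/
def closedTriangle (ℓ : ℝ) : Set (ℝ × ℝ) := {z | 0 ≤ z.2 ∧ z.2 ≤ z.1 ∧ z.1 ≤ ℓ}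

/-- Leibniz rule for functions defined on the closed triangle. -/
theorem hasDerivAt_integral_zero_self_of_triangle {ℓ : ℝ} {G G' : ℝ → ℝ → ℂ}
    (hG : ContinuousOn (Function.uncurry G) (closedTriangle ℓ))
    (hG' : ContinuousOn (Function.uncurry G') (closedTriangle ℓ))
    (hd : ∀ x y, 0 < y → y < x → x < ℓ → HasDerivAt (fun s => G s y) (G' x y) x)
    {x : ℝ} (hx : x ∈ Ioo 0 ℓ) :
    HasDerivAt (fun x => ∫ y in (0:ℝ)..x, G x y) (G x x + ∫ y in (0:ℝ)..x, G' x y) x := by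
  have hℓ : 0 < ℓ := hx.1.trans hx.2
  let c : ℝ → ℝ := fun y => max 0 (min y ℓ)
  let F : ℝ → ℝ → ℂ := fun s y => G' (max (c y) (min s ℓ)) (c y)
  let H : ℝ → ℝ → ℂ := fun s y => G (c y) (c y) + ∫ t in (c y)..s, F t y
  have hc0 : ∀ y, 0 ≤ c y := fun y => le_max_left _ _
  have hcl : ∀ y, c y ≤ ℓ := fun y => max_le hℓ.le (min_le_right _ _)
  have hcid : ∀ y, 0 ≤ y → y ≤ ℓ → c y = y := fun y h1 h2 => by simp [c, h1, h2]
  have hc : Continuous c := by fun_prop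
  have hF : Continuous (Function.uncurry F) := by
    refine hG'.comp_continuous
      (f := fun z : ℝ × ℝ => (max (c z.2) (min z.1 ℓ), c z.2)) (by fun_prop) fun z => ?_
    exact ⟨hc0 _, le_max_left _ _, max_le (hcl _) (min_le_right _ _)⟩
  have hFy : ∀ y, Continuous fun s => F s y := fun y =>
    hF.comp (by fun_prop : Continuous fun s => (s, y))
  have hH : Continuous (Function.uncurry H) := by
    have h1 : Continuous fun z : ℝ × ℝ => G (c z.2) (c z.2) :=
      hG.comp_continuous (f := fun z : ℝ × ℝ => (c z.2, c z.2)) (by fun_prop)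
        fun z => ⟨hc0 _, le_rfl, hcl _⟩
    have h2 : ∀ u : ℝ × ℝ → ℝ, Continuous u →
        Continuous fun z : ℝ × ℝ => ∫ t in (0:ℝ)..u z, F t z.2 := fun u hu =>
      continuous_parametric_intervalIntegral_of_continuous
        (f := fun (z : ℝ × ℝ) t => F t z.2)
        (hF.comp (by fun_prop : Continuous fun w : (ℝ × ℝ) × ℝ => (w.2, w.1.2))) hu
    have h3 : Function.uncurry H = fun z : ℝ × ℝ => G (c z.2) (c z.2) +
        ((∫ t in (0:ℝ)..z.1, F t z.2) - ∫ t in (0:ℝ)..c z.2, F t z.2) := by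
      funext z
      simp only [Function.uncurry, H]
      rw [integral_interval_sub_left ((hFy _).intervalIntegrable _ _)
        ((hFy _).intervalIntegrable _ _)]
    rw [h3]
    exact h1.add ((h2 _ continuous_fst).sub (h2 _ (hc.comp continuous_snd)))
  have hHd : ∀ s y, HasDerivAt (fun s => H s y) (F s y) s := fun s y =>
    ((hFy y).integral_hasStrictDerivAt _ _).hasDerivAt.const_add _
  have hHG : ∀ s y, 0 < y → y ≤ s → s ≤ ℓ → H s y = G s y := by
    intro s y hy hys hs
    have hcy := hcid y hy.le (hys.trans hs)
    have : ∫ t in y..s, G' t y = G s y - G y y := by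
      refine integral_eq_sub_of_hasDerivAt_of_le (f := fun t => G t y) hys ?_
        (fun t ht => hd t y hy ht.1 (ht.2.trans_le hs)) ?_
      · exact hG.comp (f := fun t : ℝ => (t, y)) (by fun_prop)
          fun t ht => ⟨hy.le, ht.1, ht.2.trans hs⟩
      · refine ContinuousOn.intervalIntegrable ?_
        rw [uIcc_of_le hys]
        exact hG'.comp (f := fun t : ℝ => (t, y)) (by fun_prop)
          fun t ht => ⟨hy.le, ht.1, ht.2.trans hs⟩
    have h2 : ∫ t in y..s, F t y = ∫ t in y..s, G' t y := by
      refine integral_congr fun t ht => ?_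
      rw [uIcc_of_le hys] at ht
      simp only [F, hcy]
      rw [min_eq_left (ht.2.trans hs), max_eq_right ht.1]
    simp only [H, hcy, h2, this]
    ring
  have key := hasDerivAt_integral_zero_self hH hF hHd x
  have e1 : H x x = G x x := hHG x x hx.1 le_rfl hx.2.le
  have e2 : ∫ y in (0:ℝ)..x, F x y = ∫ y in (0:ℝ)..x, G' x y := by
    refine integral_congr fun y hy => ?_
    rw [uIcc_of_le hx.1.le] at hy
    have hcy := hcid y hy.1 (hy.2.trans hx.2.le)
    simp only [F, hcy]
    rw [min_eq_left hx.2.le, max_eq_right hy.2]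
  rw [e1, e2] at key
  refine key.congr_of_eventuallyEq ?_
  filter_upwards [Ioo_mem_nhds hx.1 hx.2] with s hs
  refine integral_congr_ae (Eventually.of_forall fun y hy => ?_)
  rw [uIoc_of_le hs.1.le] at hy
  exact (hHG s y hy.1 hy.2 hs.2.le).symm

theorem hasDerivAt_derivWithin_Icc {E : Type*} [NormedAddCommGroup E] [NormedSpace ℝ E]
    {ℓ : ℝ} {f : ℝ → E} (hf : DifferentiableOn ℝ f (Icc 0 ℓ)) {x : ℝ} (hx : x ∈ Ioo 0 ℓ) :
    HasDerivAt f (derivWithin f (Icc 0 ℓ) x) x :=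
  (hf x (Ioo_subset_Icc_self hx)).hasDerivWithinAt.hasDerivAt (Icc_mem_nhds hx.1 hx.2)

/-- The linear form `(h, k) ↦ u h + v k`. -/
def linearForm (u v : ℝ) : ℝ × ℝ →L[ℝ] ℝ :=
  u • ContinuousLinearMap.fst ℝ ℝ ℝ + v • ContinuousLinearMap.snd ℝ ℝ ℝ

@[simp] theorem linearForm_apply (u v : ℝ) (z : ℝ × ℝ) :
    linearForm u v z = u * z.1 + v * z.2 := by
  simp [linearForm]

theorem eq_linearForm (L : ℝ × ℝ →L[ℝ] ℝ) : L = linearForm (L (1, 0)) (L (0, 1)) := by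
  ext <;> simp

theorem closedTriangle_mem_nhds {ℓ x y : ℝ} (hy : 0 < y) (hyx : y < x) (hx : x < ℓ) :
    closedTriangle ℓ ∈ 𝓝 (x, y) := by
  have h : IsOpen {z : ℝ × ℝ | 0 < z.2 ∧ z.2 < z.1 ∧ z.1 < ℓ} :=
    (isOpen_lt continuous_const continuous_snd).inter
      ((isOpen_lt continuous_snd continuous_fst).inter (isOpen_lt continuous_fst continuous_const))
  exact Filter.mem_of_superset (h.mem_nhds ⟨hy, hyx, hx⟩)
    fun z hz => ⟨hz.1.le, hz.2.1.le, hz.2.2.le⟩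

theorem uniqueDiffOn_closedTriangle {ℓ : ℝ} (hℓ : 0 < ℓ) :
    UniqueDiffOn ℝ (closedTriangle ℓ) := by
  refine uniqueDiffOn_convex ?_ ⟨(ℓ / 2, ℓ / 4), mem_interior_iff_mem_nhds.2
    (closedTriangle_mem_nhds (by linarith) (by linarith) (by linarith))⟩
  rintro z ⟨h1, h2, h3⟩ w ⟨k1, k2, k3⟩ s t hs ht hst
  simp only [closedTriangle, mem_ofPred_eq, Prod.snd_add, Prod.smul_snd, smul_eq_mul, Prod.fst_add,
    Prod.smul_fst]
  refine ⟨by positivity, by gcongr, ?_⟩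
  calc s * z.1 + t * w.1 ≤ s * ℓ + t * ℓ := by gcongr
    _ = ℓ := by rw [← add_mul, hst, one_mul]

theorem isCompact_closedTriangle (ℓ : ℝ) : IsCompact (closedTriangle ℓ) := by
  have h : IsCompact (Icc (0:ℝ) ℓ ×ˢ Icc (0:ℝ) ℓ) := isCompact_Icc.prod isCompact_Icc
  refine h.of_isClosed_subset ?_ fun z hz => ⟨⟨hz.1.trans hz.2.1, hz.2.2⟩, ⟨hz.1, hz.2.1.trans hz.2.2⟩⟩
  exact (isClosed_le continuous_const continuous_snd).inter
    ((isClosed_le continuous_snd continuous_fst).inter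
      (isClosed_le continuous_fst continuous_const))

/-- A solution of the Goursat problem together with the derivatives of its data: `a1, a2` are the
derivatives of `a`, and `K1, K2, K11, K12, K22` the partial derivatives of `K`. -/
structure GoursatData (ℓ : ℝ) (a a1 a2 p q : ℝ → ℝ) (K K1 K2 K11 K12 K22 : ℝ → ℝ → ℝ) : Prop where
  pos : 0 < ℓ
  a_cont : ContinuousOn a (Icc 0 ℓ)
  a1_cont : ContinuousOn a1 (Icc 0 ℓ)
  a2_cont : ContinuousOn a2 (Icc 0 ℓ)
  p_cont : ContinuousOn p (Icc 0 ℓ)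
  q_cont : ContinuousOn q (Icc 0 ℓ)
  a_pos : ∀ x ∈ Icc 0 ℓ, 0 < a x
  a_deriv : ∀ x ∈ Ioo 0 ℓ, HasDerivAt a (a1 x) x
  a1_deriv : ∀ x ∈ Ioo 0 ℓ, HasDerivAt a1 (a2 x) x
  K_cont : ContinuousOn (Function.uncurry K) (closedTriangle ℓ)
  K1_cont : ContinuousOn (Function.uncurry K1) (closedTriangle ℓ)
  K2_cont : ContinuousOn (Function.uncurry K2) (closedTriangle ℓ)
  K11_cont : ContinuousOn (Function.uncurry K11) (closedTriangle ℓ)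
  K_fderiv : ∀ x y, 0 < y → y < x → x < ℓ →
    HasFDerivAt (Function.uncurry K) (linearForm (K1 x y) (K2 x y)) (x, y)
  K1_fderiv : ∀ x y, 0 < y → y < x → x < ℓ →
    HasFDerivAt (Function.uncurry K1) (linearForm (K11 x y) (K12 x y)) (x, y)
  K2_fderiv : ∀ x y, 0 < y → y < x → x < ℓ →
    HasFDerivAt (Function.uncurry K2) (linearForm (K12 x y) (K22 x y)) (x, y)
  bottom_deriv : ∀ x ∈ Ioo 0 ℓ, HasDerivAt (fun s => K s 0) (K1 x 0) x
  diag_deriv : ∀ x ∈ Ioo 0 ℓ, HasDerivAt (fun s => K s s) (K1 x x + K2 x x) x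
  pde : ∀ x y, 0 < y → y < x → x < ℓ →
    a x * K11 x y - (a2 y * K x y + 2 * (a1 y * K2 x y) + a y * K22 x y) = (q x - p y) * K x y
  bottom : ∀ x ∈ Ioo 0 ℓ, a 0 * K2 x 0 + a1 0 * K x 0 = 0
  diag : ∀ x ∈ Ioo 0 ℓ, 2 * a x * (K1 x x + K2 x x) + a1 x * K x x = q x - p x
  zero : K 0 0 = 0

theorem HasFDerivAt.hasDerivAt_fst {f : ℝ → ℝ → ℝ} {u v x y : ℝ}
    (h : HasFDerivAt (Function.uncurry f) (linearForm u v) (x, y)) :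
    HasDerivAt (fun s => f s y) u x := by
  simpa [Function.comp_def] using HasFDerivAt.comp_hasDerivAt (f := fun s : ℝ => (s, y)) x h
    ((hasDerivAt_id' x).prodMk (hasDerivAt_const x y))

theorem HasFDerivAt.hasDerivAt_snd {f : ℝ → ℝ → ℝ} {u v x y : ℝ}
    (h : HasFDerivAt (Function.uncurry f) (linearForm u v) (x, y)) :
    HasDerivAt (fun s => f x s) v y := by
  simpa [Function.comp_def] using HasFDerivAt.comp_hasDerivAt (f := fun s : ℝ => (x, s)) y h
    ((hasDerivAt_const y x).prodMk (hasDerivAt_id' y))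

theorem ContDiffOn.exists_partials {n : ℕ} {s : Set (ℝ × ℝ)} (hs : UniqueDiffOn ℝ s)
    {f : ℝ × ℝ → ℝ} (hf : ContDiffOn ℝ (n + 1) f s) :
    ∃ f1 f2 : ℝ → ℝ → ℝ, ContDiffOn ℝ n (Function.uncurry f1) s ∧
      ContDiffOn ℝ n (Function.uncurry f2) s ∧
      ∀ z ∈ s, HasFDerivWithinAt f (linearForm (f1 z.1 z.2) (f2 z.1 z.2)) s z := by
  have h := hf.fderivWithin (m := n) hs le_rfl
  refine ⟨fun x y => fderivWithin ℝ f s (x, y) (1, 0), fun x y => fderivWithin ℝ f s (x, y) (0, 1),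
    h.clm_apply contDiffOn_const, h.clm_apply contDiffOn_const, fun z hz => ?_⟩
  rw [← eq_linearForm]
  exact (hf.differentiableOn (by simp) z hz).hasFDerivWithinAt

theorem IsGoursatSol.exists_goursatData {ℓ : ℝ} (hℓ : 0 < ℓ) {p q a : ℝ → ℝ}
    (hp : ContDiffOn ℝ 1 p (Icc 0 ℓ)) (hq : ContDiffOn ℝ 1 q (Icc 0 ℓ))
    (ha : ContDiffOn ℝ 2 a (Icc 0 ℓ)) (hapos : ∀ x ∈ Icc (0:ℝ) ℓ, 0 < a x)
    {K : ℝ → ℝ → ℝ} (hK : IsGoursatSol ℓ a p q K) :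
    ∃ (a1 a2 : ℝ → ℝ) (K1 K2 K11 K12 K22 : ℝ → ℝ → ℝ),
      GoursatData ℓ a a1 a2 p q K K1 K2 K11 K12 K22 := by
  obtain ⟨hC, hpde, hbot, hdiag, hzero⟩ := hK
  have hs := uniqueDiffOn_closedTriangle hℓ
  change ContDiffOn ℝ 2 (Function.uncurry K) (closedTriangle ℓ) at hC
  have ha' : ContDiffOn ℝ 1 (derivWithin a (Icc 0 ℓ)) (Icc 0 ℓ) :=
    ha.derivWithin (uniqueDiffOn_Icc hℓ) (by norm_num)
  have ha'' : ContDiffOn ℝ 0 (derivWithin (derivWithin a (Icc 0 ℓ)) (Icc 0 ℓ)) (Icc 0 ℓ) :=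
    ha'.derivWithin (uniqueDiffOn_Icc hℓ) (by norm_num)
  obtain ⟨K1, K2, hK1, hK2, hd⟩ := ContDiffOn.exists_partials (n := 1) hs
    (by simpa [one_add_one_eq_two] using hC)
  obtain ⟨K11, K12, hK11, -, hd1⟩ := ContDiffOn.exists_partials (n := 0) hs (by simpa using hK1)
  obtain ⟨K21, K22, -, -, hd2⟩ := ContDiffOn.exists_partials (n := 0) hs (by simpa using hK2)
  have hin : ∀ x y, 0 < y → y < x → x < ℓ → (x, y) ∈ closedTriangle ℓ :=
    fun x y h1 h2 h3 => ⟨h1.le, h2.le, h3.le⟩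
  have D : ∀ x y, 0 < y → y < x → x < ℓ →
      HasFDerivAt (Function.uncurry K) (linearForm (K1 x y) (K2 x y)) (x, y) :=
    fun x y h1 h2 h3 =>
      (hd (x, y) (hin x y h1 h2 h3)).hasFDerivAt (closedTriangle_mem_nhds h1 h2 h3)
  have D1 : ∀ x y, 0 < y → y < x → x < ℓ →
      HasFDerivAt (Function.uncurry K1) (linearForm (K11 x y) (K12 x y)) (x, y) :=
    fun x y h1 h2 h3 =>
      (hd1 (x, y) (hin x y h1 h2 h3)).hasFDerivAt (closedTriangle_mem_nhds h1 h2 h3)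
  have D2 : ∀ x y, 0 < y → y < x → x < ℓ →
      HasFDerivAt (Function.uncurry K2) (linearForm (K21 x y) (K22 x y)) (x, y) :=
    fun x y h1 h2 h3 =>
      (hd2 (x, y) (hin x y h1 h2 h3)).hasFDerivAt (closedTriangle_mem_nhds h1 h2 h3)
  have open_nhds : ∀ x y, 0 < y → y < x → x < ℓ →
      ∀ᶠ z : ℝ × ℝ in 𝓝 (x, y), 0 < z.2 ∧ z.2 < z.1 ∧ z.1 < ℓ := fun x y h1 h2 h3 =>
    (continuous_const.continuousAt.eventually_lt continuous_snd.continuousAt h1).and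
      ((continuous_snd.continuousAt.eventually_lt continuous_fst.continuousAt h2).and
        (continuous_fst.continuousAt.eventually_lt continuous_const.continuousAt h3))
  have symm : ∀ x y, 0 < y → y < x → x < ℓ → K21 x y = K12 x y := by
    intro x y h1 h2 h3
    have hL : HasFDerivAt (fun z : ℝ × ℝ => linearForm (K1 z.1 z.2) (K2 z.1 z.2))
        ((linearForm (K11 x y) (K12 x y)).smulRight (ContinuousLinearMap.fst ℝ ℝ ℝ) +
        (linearForm (K21 x y) (K22 x y)).smulRight (ContinuousLinearMap.snd ℝ ℝ ℝ)) (x, y) :=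
      ((D1 x y h1 h2 h3).smul_const (ContinuousLinearMap.fst ℝ ℝ ℝ)).add
        ((D2 x y h1 h2 h3).smul_const (ContinuousLinearMap.snd ℝ ℝ ℝ))
    have := second_derivative_symmetric_of_eventually
      ((open_nhds x y h1 h2 h3).mono fun z hz => D z.1 z.2 hz.1 hz.2.1 hz.2.2) hL (1, 0) (0, 1)
    simpa using this
  have ax : ∀ x ∈ Ioo 0 ℓ, HasDerivAt a (derivWithin a (Icc 0 ℓ) x) x := fun x hx =>
    hasDerivAt_derivWithin_Icc (ha.differentiableOn (by norm_num)) hx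
  have a1x : ∀ x ∈ Ioo 0 ℓ, HasDerivAt (derivWithin a (Icc 0 ℓ))
      (derivWithin (derivWithin a (Icc 0 ℓ)) (Icc 0 ℓ) x) x := fun x hx =>
    hasDerivAt_derivWithin_Icc (ha'.differentiableOn (by norm_num)) hx
  have dg : ∀ x ∈ Ioo 0 ℓ, HasDerivAt (fun s => K s s) (K1 x x + K2 x x) x := by
    intro x hx
    have := HasFDerivWithinAt.comp_hasDerivAt (f := fun s : ℝ => (s, s)) x
      (hd (x, x) ⟨hx.1.le, le_rfl, hx.2.le⟩) ((hasDerivAt_id' x).prodMk (hasDerivAt_id' x)) (by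
        filter_upwards [Ioo_mem_nhds hx.1 hx.2] with s hs
        exact ⟨hs.1.le, le_rfl, hs.2.le⟩)
    simpa [Function.comp_def] using this
  refine ⟨derivWithin a (Icc 0 ℓ), derivWithin (derivWithin a (Icc 0 ℓ)) (Icc 0 ℓ),
    K1, K2, K11, K12, K22, hℓ, ha.continuousOn, ha'.continuousOn, ha''.continuousOn,
    hp.continuousOn, hq.continuousOn, hapos, ax, a1x, hC.continuousOn, hK1.continuousOn,
    hK2.continuousOn, hK11.continuousOn, D, D1, ?_, ?_, dg, ?_, ?_, ?_, hzero⟩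
  · intro x y h1 h2 h3
    rw [← symm x y h1 h2 h3]
    exact D2 x y h1 h2 h3
  · intro x hx
    have := HasFDerivWithinAt.comp_hasDerivAt (f := fun s : ℝ => (s, (0:ℝ))) x
      (hd (x, 0) ⟨le_rfl, hx.1.le, hx.2.le⟩) ((hasDerivAt_id' x).prodMk (hasDerivAt_const x 0)) (by
        filter_upwards [Ioo_mem_nhds hx.1 hx.2] with s hs
        exact ⟨le_rfl, hs.1.le, hs.2.le⟩)
    simpa [Function.comp_def] using this
  · intro x y h1 h2 h3
    have e1 : deriv (fun s => deriv (fun s' => K s' y) s) x = K11 x y := by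
      rw [← (D1 x y h1 h2 h3).hasDerivAt_fst.deriv]
      refine Filter.EventuallyEq.deriv_eq ?_
      filter_upwards [Ioo_mem_nhds h2 h3] with s hs
      exact (D s y h1 hs.1 hs.2).hasDerivAt_fst.deriv
    have hyℓ : y < ℓ := h2.trans h3
    have e2 : HasDerivAt (fun s => deriv (fun s' => a s' * K x s') s)
        (derivWithin (derivWithin a (Icc 0 ℓ)) (Icc 0 ℓ) y * K x y
          + derivWithin a (Icc 0 ℓ) y * K2 x y
          + (derivWithin a (Icc 0 ℓ) y * K2 x y + a y * K22 x y)) y := by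
      refine (((a1x y ⟨h1, hyℓ⟩).mul (D x y h1 h2 h3).hasDerivAt_snd).add
        ((ax y ⟨h1, hyℓ⟩).mul (D2 x y h1 h2 h3).hasDerivAt_snd)).congr_of_eventuallyEq ?_
      filter_upwards [Ioo_mem_nhds h1 h2] with s hs
      exact ((ax s ⟨hs.1, hs.2.trans h3⟩).mul (D x s hs.1 hs.2 h3).hasDerivAt_snd).deriv
    have h4 := hpde x y h1 h2 h3
    rw [e1, e2.deriv] at h4
    linarith
  · intro x hx
    have := (hd (x, 0) ⟨le_rfl, hx.1.le, hx.2.le⟩).comp_hasDerivWithinAt_of_eq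
      (f := fun s : ℝ => (x, s))
      (s := Icc 0 x) 0 ((hasDerivWithinAt_const _ _ x).prodMk (hasDerivWithinAt_id _ _))
        (fun s hs => ⟨hs.1, hs.2, hx.2.le⟩) rfl
    have h2 : HasDerivWithinAt (fun s => K x s) (K2 x 0) (Icc 0 x) 0 := by
      simpa [Function.comp_def] using this
    have h3 := hbot x hx.1 hx.2
    rwa [h2.derivWithin (uniqueDiffOn_Icc hx.1 0 ⟨le_rfl, hx.1.le⟩)] at h3
  · intro x hx
    have h3 := hdiag x hx.1 hx.2
    rwa [(dg x hx).hasDerivWithinAt.derivWithin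
      (uniqueDiffOn_Icc hℓ x (Ioo_subset_Icc_self hx))] at h3

theorem ContinuousOn.triangle_vertical {ℓ x : ℝ} {f : ℝ → ℝ → ℝ}
    (hf : ContinuousOn (Function.uncurry f) (closedTriangle ℓ)) (hx : x ≤ ℓ) :
    ContinuousOn (fun y => f x y) (Icc 0 x) :=
  hf.comp (f := fun y : ℝ => (x, y)) (by fun_prop) fun _ hy => ⟨hy.1, hy.2, hx⟩

theorem ContinuousOn.triangle_mul_snd {ℓ : ℝ} {f : ℝ → ℝ → ℝ} {b : ℝ → ℂ}
    (hf : ContinuousOn (Function.uncurry f) (closedTriangle ℓ)) (hb : ContinuousOn b (Icc 0 ℓ)) :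
    ContinuousOn (Function.uncurry fun x y => (f x y : ℂ) * b y) (closedTriangle ℓ) :=
  (Complex.continuous_ofReal.comp_continuousOn hf).mul
    (hb.comp continuousOn_snd fun _ hz => ⟨hz.1, hz.2.1.trans hz.2.2⟩)

/-- Differentiating the relation `∫₀ˣ K(x,y) b(y) dy = 0` twice and integrating by parts expresses
`(q - p) b` through `K`. -/
theorem GoursatData.moment_identity {ℓ : ℝ} {a a1 a2 p q : ℝ → ℝ}
    {K K1 K2 K11 K12 K22 : ℝ → ℝ → ℝ} (h : GoursatData ℓ a a1 a2 p q K K1 K2 K11 K12 K22)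
    {b b1 b2 : ℝ → ℂ} (hb : ContinuousOn b (Icc 0 ℓ)) (hb1 : ContinuousOn b1 (Icc 0 ℓ))
    (hb2 : ContinuousOn b2 (Icc 0 ℓ)) (db : ∀ x ∈ Ioo 0 ℓ, HasDerivAt b (b1 x) x)
    (db1 : ∀ x ∈ Ioo 0 ℓ, HasDerivAt b1 (b2 x) x) (hb0 : b 0 = 0)
    (hker : ∀ x ∈ Ioo 0 ℓ, ∫ y in (0:ℝ)..x, (K x y : ℂ) * b y = 0) {x : ℝ} (hx : x ∈ Ioo 0 ℓ) :
    (q x - p x) * b x + a 0 * K x 0 * b1 0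
      + ∫ y in (0:ℝ)..x, (K x y : ℂ) * (a y * b2 y - p y * b y) = 0 := by
  have hxI : Icc 0 x ⊆ Icc 0 ℓ := Icc_subset_Icc_right hx.2.le
  have D0 : ∀ s ∈ Ioo 0 ℓ, HasDerivAt (fun x => ∫ y in (0:ℝ)..x, (K x y : ℂ) * b y)
      ((K s s : ℂ) * b s + ∫ y in (0:ℝ)..s, (K1 s y : ℂ) * b y) s := fun s hs =>
    hasDerivAt_integral_zero_self_of_triangle (h.K_cont.triangle_mul_snd hb)
      (h.K1_cont.triangle_mul_snd hb)
      (fun x y h1 h2 h3 => (h.K_fderiv x y h1 h2 h3).hasDerivAt_fst.ofReal_comp.mul_const _) hs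
  have D1 : HasDerivAt (fun x => ∫ y in (0:ℝ)..x, (K1 x y : ℂ) * b y)
      ((K1 x x : ℂ) * b x + ∫ y in (0:ℝ)..x, (K11 x y : ℂ) * b y) x :=
    hasDerivAt_integral_zero_self_of_triangle (h.K1_cont.triangle_mul_snd hb)
      (h.K11_cont.triangle_mul_snd hb)
      (fun x y h1 h2 h3 => (h.K1_fderiv x y h1 h2 h3).hasDerivAt_fst.ofReal_comp.mul_const _) hx
  have Z0 : ∀ s ∈ Ioo 0 ℓ, (K s s : ℂ) * b s + ∫ y in (0:ℝ)..s, (K1 s y : ℂ) * b y = 0 := by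
    intro s hs
    refine (D0 s hs).unique ((hasDerivAt_const s (0:ℂ)).congr_of_eventuallyEq ?_)
    filter_upwards [Ioo_mem_nhds hs.1 hs.2] with t ht using hker t ht
  have Z1 := ((((h.diag_deriv x hx).ofReal_comp.mul (db x hx)).add D1)).unique
    ((hasDerivAt_const x (0:ℂ)).congr_of_eventuallyEq (by
      filter_upwards [Ioo_mem_nhds hx.1 hx.2] with t ht using Z0 t ht))
  have cK := h.K_cont.triangle_vertical hx.2.le
  have cK2 := h.K2_cont.triangle_vertical hx.2.le
  have cK11 := h.K11_cont.triangle_vertical hx.2.le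
  have ca := h.a_cont.mono hxI
  have ca1 := h.a1_cont.mono hxI
  have cp := h.p_cont.mono hxI
  have cb := hb.mono hxI
  have cb1 := hb1.mono hxI
  have cb2 := hb2.mono hxI
  have ofR : ∀ {f : ℝ → ℝ}, ContinuousOn f (Icc 0 x) →
      ContinuousOn (fun y => (f y : ℂ)) (Icc 0 x) :=
    fun hf => Complex.continuous_ofReal.comp_continuousOn hf
  have ii : ∀ {f : ℝ → ℂ}, ContinuousOn f (Icc 0 x) → IntervalIntegrable f volume 0 x := fun hf =>
    ContinuousOn.intervalIntegrable (by rwa [uIcc_of_le hx.1.le])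
  have i11 : IntervalIntegrable (fun y => (K11 x y : ℂ) * b y) volume 0 x := ii ((ofR cK11).mul cb)
  have i0 : IntervalIntegrable (fun y => (K x y : ℂ) * b y) volume 0 x := ii ((ofR cK).mul cb)
  have iI : IntervalIntegrable
      (fun y => (K x y : ℂ) * (a y * b2 y - p y * b y)) volume 0 x :=
    ii ((ofR cK).mul (((ofR ca).mul cb2).sub ((ofR cp).mul cb)))
  have ftc : ∫ y in (0:ℝ)..x, (a x * (K11 x y * b y) - q x * (K x y * b y)
        - K x y * (a y * b2 y - p y * b y)) =
      (((a1 x * K x x + a x * K2 x x : ℝ) : ℂ) * b x - ((a x * K x x : ℝ) : ℂ) * b1 x)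
      - (((a1 0 * K x 0 + a 0 * K2 x 0 : ℝ) : ℂ) * b 0 - ((a 0 * K x 0 : ℝ) : ℂ) * b1 0) := by
    refine integral_eq_sub_of_hasDerivAt_of_le
      (f := fun y => ((a1 y * K x y + a y * K2 x y : ℝ) : ℂ) * b y
        - ((a y * K x y : ℝ) : ℂ) * b1 y) hx.1.le ?_ ?_ ?_
    · exact ((ofR ((ca1.mul cK).add (ca.mul cK2))).mul cb).sub ((ofR (ca.mul cK)).mul cb1)
    · intro y hy
      have hy' : y ∈ Ioo 0 ℓ := ⟨hy.1, hy.2.trans hx.2⟩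
      have dK := (h.K_fderiv x y hy.1 hy.2 hx.2).hasDerivAt_snd
      have dK2 := (h.K2_fderiv x y hy.1 hy.2 hx.2).hasDerivAt_snd
      have da := h.a_deriv y hy'
      have := ((((h.a1_deriv y hy').mul dK).add (da.mul dK2)).ofReal_comp.mul (db y hy')).sub
        ((da.mul dK).ofReal_comp.mul (db1 y hy'))
      convert! this using 1
      have hp := congrArg (fun t : ℝ => (t : ℂ)) (h.pde x y hy.1 hy.2 hx.2)
      simp only [Pi.add_apply, Pi.mul_apply]
      push_cast at hp ⊢
      linear_combination b y * hp
    · exact ((i11.const_mul _).sub (i0.const_mul _)).sub iI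
  rw [intervalIntegral.integral_sub ((i11.const_mul _).sub (i0.const_mul _)) iI,
    intervalIntegral.integral_sub (i11.const_mul _) (i0.const_mul _),
    intervalIntegral.integral_const_mul, intervalIntegral.integral_const_mul, hker x hx, hb0] at ftc
  have hdiag := congrArg (fun t : ℝ => (t : ℂ)) (h.diag x hx)
  push_cast at ftc hdiag Z1
  linear_combination (-b x) * hdiag - ftc + (a x : ℂ) * Z1

/-- The flow from `0` of the vector field `σ` on the line. -/
theorem exists_orderIso_hasDerivAt {σ : ℝ → ℝ} (hσ : Continuous σ) {c C : ℝ} (hc : 0 < c)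
    (hcσ : ∀ x, c ≤ σ x) (hσC : ∀ x, σ x ≤ C) :
    ∃ φ : ℝ ≃o ℝ, φ 0 = 0 ∧ ∀ X, HasDerivAt φ (σ (φ X)) X := by
  have hpos : ∀ x, 0 < σ x := fun x => hc.trans_le (hcσ x)
  have hC : 0 < C := (hpos 0).trans_le (hσC 0)
  have hcont : Continuous fun x => (σ x)⁻¹ := hσ.inv₀ fun x => (hpos x).ne'
  let F : ℝ → ℝ := fun x => ∫ t in (0:ℝ)..x, (σ t)⁻¹
  have hF : ∀ x, HasDerivAt F (σ x)⁻¹ x := fun x => (hcont.integral_hasStrictDerivAt 0 x).hasDerivAt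
  have hF0 : F 0 = 0 := by simp [F]
  have hmono : StrictMono F := strictMono_of_hasDerivAt_pos hF fun x => inv_pos.2 (hpos x)
  have hG : Monotone fun x => F x - C⁻¹ * x := by
    have hd : ∀ x, HasDerivAt (fun x => F x - C⁻¹ * x) ((σ x)⁻¹ - C⁻¹ * 1) x := fun x =>
      (hF x).sub ((hasDerivAt_id' x).const_mul _)
    refine monotone_of_deriv_nonneg (fun x => (hd x).differentiableAt) fun x => ?_
    rw [(hd x).deriv, mul_one, sub_nonneg]
    exact inv_anti₀ (hpos x) (hσC x)
  have hsurj : Function.Surjective F := by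
    refine (continuous_iff_continuousAt.2 fun x => (hF x).continuousAt).surjective ?_ ?_
    · refine Filter.tendsto_atTop_mono' _ ?_
        (Filter.tendsto_id.const_mul_atTop (inv_pos.2 hC))
      filter_upwards [Filter.eventually_ge_atTop 0] with x hx
      have := hG hx
      simp only [hF0] at this
      simp only [id]
      linarith
    · refine Filter.tendsto_atBot_mono' _ ?_
        (Filter.tendsto_id.const_mul_atBot (inv_pos.2 hC))
      filter_upwards [Filter.eventually_le_atBot 0] with x hx
      have := hG hx
      simp only [hF0] at this
      simp only [id]
      linarith
  let e : ℝ ≃o ℝ := hmono.orderIsoOfSurjective F hsurj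
  refine ⟨e.symm, by rw [OrderIso.symm_apply_eq]; exact hF0.symm, fun X => ?_⟩
  have := HasDerivAt.of_local_left_inverse (f := F) (g := e.symm) (a := X)
    e.symm.continuous.continuousAt (hF _) (inv_ne_zero (hpos _).ne')
    (Filter.Eventually.of_forall fun y => e.apply_symm_apply y)
  rwa [inv_inv] at this

theorem abs_sub_le_of_hasDerivAt_Ioo {f f' : ℝ → ℝ} {u v R : ℝ} (huv : u ≤ v)
    (hf : ContinuousOn f (Icc u v)) (hd : ∀ t ∈ Ioo u v, HasDerivAt f (f' t) t)
    (hR : ∀ t ∈ Ioo u v, |f' t| ≤ R) : |f v - f u| ≤ R * (v - u) := by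
  rcases huv.eq_or_lt with rfl | huv
  · simp
  obtain ⟨t, ht, h⟩ := exists_hasDerivAt_eq_slope f f' huv hf hd
  have h1 : 0 < v - u := sub_pos.2 huv
  have h2 := hR t ht
  rwa [h, abs_div, abs_of_pos h1, div_le_iff₀ h1] at h2

section Estimates

variable {ℓ : ℝ} {a a1 a2 p q : ℝ → ℝ} {K K1 K2 K11 K12 K22 : ℝ → ℝ → ℝ}

/-- The first derivatives of `K` are bounded by `S` for `0 ≤ y < x ≤ δ`. -/
def GradientBound (K1 K2 : ℝ → ℝ → ℝ) (δ S : ℝ) : Prop :=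
  ∀ x y, 0 ≤ y → y < x → x ≤ δ → |K1 x y| ≤ S ∧ |K2 x y| ≤ S

theorem GoursatData.abs_bottom_le (h : GoursatData ℓ a a1 a2 p q K K1 K2 K11 K12 K22) {δ S : ℝ}
    (hδ : δ ≤ ℓ) {x : ℝ} (hx : 0 ≤ x) (hxδ : x ≤ δ) (hS : ∀ s ∈ Ioo 0 x, |K1 s 0| ≤ S) :
    |K x 0| ≤ S * x := by
  have := abs_sub_le_of_hasDerivAt_Ioo (f := fun s => K s 0) hx
    (h.K_cont.comp (f := fun s : ℝ => (s, (0:ℝ))) (by fun_prop)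
      fun s hs => ⟨le_rfl, hs.1, hs.2.trans (hxδ.trans hδ)⟩)
    (fun s hs => h.bottom_deriv s ⟨hs.1, hs.2.trans_le (hxδ.trans hδ)⟩) hS
  simpa [h.zero] using this

theorem GoursatData.abs_kernel_le (h : GoursatData ℓ a a1 a2 p q K K1 K2 K11 K12 K22) {δ S : ℝ}
    (hδ : δ < ℓ) (hB : GradientBound K1 K2 δ S) {x y : ℝ} (hy : 0 ≤ y) (hyx : y ≤ x)
    (hxδ : x ≤ δ) : |K x y| ≤ 2 * x * S := by
  rcases (hy.trans hyx).eq_or_lt with rfl | hx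
  · obtain rfl : y = 0 := le_antisymm hyx hy
    simp [h.zero]
  have hS : 0 ≤ S := (abs_nonneg _).trans (hB x 0 le_rfl hx hxδ).1
  have h0 := h.abs_bottom_le hδ.le hx.le hxδ
    fun s hs => (hB s 0 le_rfl hs.1 (hs.2.le.trans hxδ)).1
  have h1 := abs_sub_le_of_hasDerivAt_Ioo (f := fun s => K x s) hy
    ((h.K_cont.triangle_vertical (hxδ.trans hδ.le)).mono (Icc_subset_Icc_right hyx))
    (fun s hs => (h.K_fderiv x s hs.1 (hs.2.trans_le hyx) (hxδ.trans_lt hδ)).hasDerivAt_snd)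
    (fun s hs => (hB x s hs.1.le (hs.2.trans_le hyx) hxδ).2)
  calc |K x y| = |(K x y - K x 0) + K x 0| := by ring_nf
    _ ≤ |K x y - K x 0| + |K x 0| := abs_add_le _ _
    _ ≤ S * (y - 0) + S * x := add_le_add h1 h0
    _ ≤ 2 * x * S := by nlinarith

/-- Variation of `σ(x) ∂ₓK ± σ(y) ∂_yK`, `σ = √a`, along a characteristic curve. -/
theorem GoursatData.abs_transport_le (h : GoursatData ℓ a a1 a2 p q K K1 K2 K11 K12 K22)
    {B δ S : ℝ} (ha1 : ∀ x ∈ Icc 0 ℓ, |a1 x| ≤ B) (ha2 : ∀ x ∈ Icc 0 ℓ, |a2 x| ≤ B)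
    (hp : ∀ x ∈ Icc 0 ℓ, |p x| ≤ B) (hq : ∀ x ∈ Icc 0 ℓ, |q x| ≤ B)
    (hδ : δ < ℓ) (hB : GradientBound K1 K2 δ S)
    {σ : ℝ → ℝ} (hσ : Continuous σ) (hσa : ∀ x ∈ Icc 0 ℓ, σ x = √(a x))
    {φ : ℝ ≃o ℝ} (hφ : ∀ X, HasDerivAt φ (σ (φ X)) X) (hφ0 : φ 0 = 0)
    {ε X Y τ : ℝ} (hε : ε ^ 2 = 1) (hτ : 0 ≤ τ) (hX : φ X ≤ δ)
    (hcl : ∀ t ∈ Icc 0 τ, 0 ≤ Y + ε * t ∧ Y + ε * t ≤ X - t)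
    (hop : ∀ t ∈ Ioo 0 τ, 0 < Y + ε * t ∧ Y + ε * t < X - t) :
    |(σ (φ (X - τ)) * K1 (φ (X - τ)) (φ (Y + ε * τ))
        + ε * (σ (φ (Y + ε * τ)) * K2 (φ (X - τ)) (φ (Y + ε * τ))))
      - (σ (φ X) * K1 (φ X) (φ Y) + ε * (σ (φ Y) * K2 (φ X) (φ Y)))|
      ≤ (3 + 6 * ℓ) * B * S * τ := by
  have hφpos : ∀ {t}, 0 < t → 0 < φ t := fun ht => by
    rw [← hφ0]; exact φ.strictMono ht
  have hφnn : ∀ {t}, 0 ≤ t → 0 ≤ φ t := fun ht => by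
    rw [← hφ0]; exact φ.monotone ht
  have hle : ∀ {t}, 0 ≤ t → φ (X - t) ≤ δ := fun ht =>
    (φ.monotone (by linarith)).trans hX
  have hψ : ∀ T, φ T ∈ Ioo 0 ℓ → HasDerivAt (fun T => σ (φ T)) (a1 (φ T) / 2) T := by
    intro T hT
    have hpos := h.a_pos _ (Ioo_subset_Icc_self hT)
    have h1 := ((h.a_deriv _ hT).comp T (hφ T)).sqrt hpos.ne'
    have heq : (fun T => σ (φ T)) =ᶠ[𝓝 T] fun T => √((a ∘ φ) T) := by
      have : ∀ᶠ s in 𝓝 T, φ s ∈ Ioo 0 ℓ := φ.continuous.continuousAt (Ioo_mem_nhds hT.1 hT.2)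
      filter_upwards [this] with s hs using hσa _ (Ioo_subset_Icc_self hs)
    convert! h1.congr_of_eventuallyEq heq using 1
    rw [hσa _ (Ioo_subset_Icc_self hT)]
    have := Real.sqrt_pos.2 hpos
    simp only [Function.comp_apply]
    field_simp
  let w : ℝ → ℝ := fun t => σ (φ (X - t)) * K1 (φ (X - t)) (φ (Y + ε * t))
      + ε * (σ (φ (Y + ε * t)) * K2 (φ (X - t)) (φ (Y + ε * t)))
  have hpath : Continuous fun t => (φ (X - t), φ (Y + ε * t)) :=
    (φ.continuous.comp (by fun_prop)).prodMk (φ.continuous.comp (by fun_prop))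
  have hmaps : MapsTo (fun t => (φ (X - t), φ (Y + ε * t))) (Icc 0 τ) (closedTriangle ℓ) :=
    fun t ht => ⟨hφnn (hcl t ht).1, φ.monotone (hcl t ht).2, (hle ht.1).trans hδ.le⟩
  have hwc : ContinuousOn w (Icc 0 τ) := by
    have c1 := h.K1_cont.comp hpath.continuousOn hmaps
    have c2 := h.K2_cont.comp hpath.continuousOn hmaps
    have c3 : Continuous fun t => σ (φ (X - t)) := hσ.comp (φ.continuous.comp (by fun_prop))
    have c4 : Continuous fun t => σ (φ (Y + ε * t)) := hσ.comp (φ.continuous.comp (by fun_prop))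
    exact (c3.continuousOn.mul c1).add ((c4.continuousOn.mul c2).const_smul ε)
  have hwd : ∀ t ∈ Ioo 0 τ, ∃ d, HasDerivAt w d t ∧ |d| ≤ (3 + 6 * ℓ) * B * S := by
    intro t ht
    obtain ⟨hY, hYX⟩ := hop t ht
    set x := φ (X - t) with hx
    set y := φ (Y + ε * t) with hy
    have hy0 : 0 < y := hφpos hY
    have hyx : y < x := φ.strictMono hYX
    have hxδ : x ≤ δ := hle ht.1.le
    have hxℓ : x < ℓ := hxδ.trans_lt hδ
    have hxI : x ∈ Ioo 0 ℓ := ⟨hy0.trans hyx, hxℓ⟩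
    have hyI : y ∈ Ioo 0 ℓ := ⟨hy0, hyx.trans hxℓ⟩
    have e1 : HasDerivAt (fun t => X - t) (-1) t := by
      simpa using (hasDerivAt_id' t).const_sub X
    have e2 : HasDerivAt (fun t => Y + ε * t) ε t := by
      simpa using ((hasDerivAt_id' t).const_mul ε).const_add Y
    have dx : HasDerivAt (fun t => φ (X - t)) (σ x * -1) t := (hφ (X - t)).comp t e1
    have dy : HasDerivAt (fun t => φ (Y + ε * t)) (σ y * ε) t := (hφ (Y + ε * t)).comp t e2
    have dσx : HasDerivAt (fun t => σ (φ (X - t))) (a1 x / 2 * -1) t :=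
      HasDerivAt.comp (h₂ := fun T => σ (φ T)) t (hψ (X - t) hxI) e1
    have dσy : HasDerivAt (fun t => σ (φ (Y + ε * t))) (a1 y / 2 * ε) t :=
      HasDerivAt.comp (h₂ := fun T => σ (φ T)) t (hψ (Y + ε * t) hyI) e2
    have dK1 := (h.K1_fderiv x y hy0 hyx hxℓ).comp_hasDerivAt_of_eq t (dx.prodMk dy) rfl
    have dK2 := (h.K2_fderiv x y hy0 hyx hxℓ).comp_hasDerivAt_of_eq t (dx.prodMk dy) rfl
    refine ⟨_, (dσx.mul dK1).add ((dσy.mul dK2).const_mul ε), ?_⟩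
    simp only [linearForm_apply, Function.comp_apply, Function.uncurry]
    rw [← hx, ← hy]
    have sx : σ x * σ x = a x := by
      rw [hσa x (Ioo_subset_Icc_self hxI),
        Real.mul_self_sqrt (h.a_pos x (Ioo_subset_Icc_self hxI)).le]
    have sy : σ y * σ y = a y := by
      rw [hσa y (Ioo_subset_Icc_self hyI),
        Real.mul_self_sqrt (h.a_pos y (Ioo_subset_Icc_self hyI)).le]
    have hpde := h.pde x y hy0 hyx hxℓ
    have hval : a1 x / 2 * -1 * K1 x y + σ x * (K11 x y * (σ x * -1) + K12 x y * (σ y * ε))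
        + ε * (a1 y / 2 * ε * K2 x y + σ y * (K12 x y * (σ x * -1) + K22 x y * (σ y * ε)))
        = -(a1 x * K1 x y) / 2 - 3 / 2 * (a1 y * K2 x y) - a2 y * K x y - q x * K x y
          + p y * K x y := by
      linear_combination (-K11 x y) * sx + (K22 x y * ε ^ 2) * sy - hpde
        + (a1 y * K2 x y / 2 + a y * K22 x y) * hε
    rw [hval]
    have b := hB x y hy0.le hyx hxδ
    have hS : 0 ≤ S := (abs_nonneg _).trans b.1
    have hxS : x * S ≤ ℓ * S := by gcongr
    have bK : |K x y| ≤ 2 * (ℓ * S) := (h.abs_kernel_le hδ hB hy0.le hyx.le hxδ).trans (by linarith)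
    have hB0 : 0 ≤ B := (abs_nonneg _).trans (ha1 x (Ioo_subset_Icc_self hxI))
    have mulb : ∀ {u v U V : ℝ}, |u| ≤ U → |v| ≤ V → |u * v| ≤ U * V := fun hu hv => by
      rw [abs_mul]; exact mul_le_mul hu hv (abs_nonneg _) ((abs_nonneg _).trans hu)
    have t1 := abs_le.1 (mulb (ha1 x (Ioo_subset_Icc_self hxI)) b.1)
    have t2 := abs_le.1 (mulb (ha1 y (Ioo_subset_Icc_self hyI)) b.2)
    have t3 := abs_le.1 (mulb (ha2 y (Ioo_subset_Icc_self hyI)) bK)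
    have t4 := abs_le.1 (mulb (hq x (Ioo_subset_Icc_self hxI)) bK)
    have t5 := abs_le.1 (mulb (hp y (Ioo_subset_Icc_self hyI)) bK)
    have t0 : 0 ≤ B * S := mul_nonneg hB0 hS
    rw [abs_le]
    constructor <;> linarith
  choose! d hd hdb using hwd
  have := abs_sub_le_of_hasDerivAt_Ioo hτ hwc hd hdb
  simpa [w] using this


theorem GoursatData.gradientBound_improve (h : GoursatData ℓ a a1 a2 p q K K1 K2 K11 K12 K22)
    {B δ S : ℝ} (ha1 : ∀ x ∈ Icc 0 ℓ, |a1 x| ≤ B) (ha2 : ∀ x ∈ Icc 0 ℓ, |a2 x| ≤ B)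
    (hp : ∀ x ∈ Icc 0 ℓ, |p x| ≤ B) (hq : ∀ x ∈ Icc 0 ℓ, |q x| ≤ B)
    (hδ : δ < ℓ) (hB : GradientBound K1 K2 δ S)
    {σ : ℝ → ℝ} (hσ : Continuous σ) (hσa : ∀ x ∈ Icc 0 ℓ, σ x = √(a x))
    {φ : ℝ ≃o ℝ} (hφ : ∀ X, HasDerivAt φ (σ (φ X)) X) (hφ0 : φ 0 = 0)
    {c M : ℝ} (hc : 0 < c) (hcσ : ∀ x, c ≤ σ x) (hM : ∀ x ∈ Ioc 0 δ, |q x - p x| ≤ M) :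
    GradientBound K1 K2 δ ((M / 2 + (11 + 12 * ℓ) * B * δ * S) / c ^ 2) := by
  have hB0 : 0 ≤ B := (abs_nonneg _).trans (ha1 0 ⟨le_rfl, h.pos.le⟩)
  have hℓ := h.pos
  have hσ2 : ∀ x ∈ Icc 0 ℓ, σ x * σ x = a x := fun x hx => by
    rw [hσa x hx, Real.mul_self_sqrt (h.a_pos x hx).le]
  have hφs0 : φ.symm 0 = 0 := by rw [OrderIso.symm_apply_eq, hφ0]
  have hsnn : ∀ {x}, 0 ≤ x → 0 ≤ φ.symm x := fun hx => by
    rw [← hφs0]; exact φ.symm.monotone hx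
  have hmono : Monotone fun X => φ X - c * X := by
    have hd : ∀ X, HasDerivAt (fun X => φ X - c * X) (σ (φ X) - c * 1) X := fun X =>
      (hφ X).sub ((hasDerivAt_id' X).const_mul c)
    refine monotone_of_deriv_nonneg (fun X => (hd X).differentiableAt) fun X => ?_
    rw [(hd X).deriv, mul_one, sub_nonneg]
    exact hcσ _
  have htime : ∀ {x}, 0 ≤ x → x ≤ δ → c * φ.symm x ≤ δ := fun {x} hx hxδ => by
    have := hmono (hsnn hx)
    simp only [hφ0, OrderIso.apply_symm_apply] at this
    linarith
  have le_of_mul : ∀ {u v s : ℝ}, c ≤ s → |s * u| ≤ v → c * |u| ≤ v := fun {u v s} hs hu => by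
    rw [abs_mul, abs_of_pos (hc.trans_le hs)] at hu
    exact (mul_le_mul_of_nonneg_right hs (abs_nonneg _)).trans hu
  have hdiag : ∀ m, 0 < m → m ≤ δ → c * |σ m * K1 m m + σ m * K2 m m| ≤ M / 2 + B * δ * S := by
    intro m hm hmδ
    have hmI : m ∈ Ioo 0 ℓ := ⟨hm, hmδ.trans_lt hδ⟩
    have hS : 0 ≤ S := (abs_nonneg _).trans (hB m 0 le_rfl hm hmδ).1
    refine le_of_mul (hcσ m) ?_
    have e : σ m * (σ m * K1 m m + σ m * K2 m m) = ((q m - p m) - a1 m * K m m) / 2 := by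
      linear_combination (K1 m m + K2 m m) * hσ2 m (Ioo_subset_Icc_self hmI) + h.diag m hmI / 2
    have k1 : |a1 m * K m m| ≤ B * (2 * δ * S) := by
      rw [abs_mul]
      refine mul_le_mul (ha1 m (Ioo_subset_Icc_self hmI)) ?_ (abs_nonneg _) hB0
      refine (h.abs_kernel_le hδ hB hm.le le_rfl hmδ).trans ?_
      gcongr
    rw [e, abs_div, abs_two]
    have := abs_sub (q m - p m) (a1 m * K m m)
    have := hM m ⟨hm, hmδ⟩
    linarith
  have hplus : ∀ x y, 0 ≤ y → y < x → x ≤ δ →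
      c * |σ x * K1 x y + σ y * K2 x y| ≤ M / 2 + (4 + 6 * ℓ) * B * δ * S := by
    intro x y hy hyx hxδ
    have hS : 0 ≤ S := (abs_nonneg _).trans (hB x y hy hyx hxδ).1
    have hx : 0 < x := hy.trans_lt hyx
    have hY := hsnn hy
    have hYX : φ.symm y < φ.symm x := φ.symm.strictMono hyx
    have ht := htime hx.le hxδ
    set X := φ.symm x with hX
    set Y := φ.symm y with hY'
    have hφX : φ X = x := φ.apply_symm_apply x
    have hφY : φ Y = y := φ.apply_symm_apply y
    have tr := h.abs_transport_le ha1 ha2 hp hq hδ hB hσ hσa hφ hφ0 (ε := 1) (X := X) (Y := Y)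
      (τ := (X - Y) / 2) (by norm_num) (by linarith) (by rwa [hφX])
      (fun t ht => ⟨by linarith [ht.1], by linarith [ht.2]⟩)
      (fun t ht => ⟨by linarith [ht.1], by linarith [ht.2]⟩)
    rw [show Y + 1 * ((X - Y) / 2) = X - (X - Y) / 2 by ring, hφX, hφY] at tr
    set m := φ (X - (X - Y) / 2)
    simp only [one_mul] at tr
    have hm0 : 0 < m := by
      rw [← hφ0]; exact φ.strictMono (by linarith)
    have hmx : m ≤ δ := (φ.monotone (by linarith : X - (X - Y) / 2 ≤ X)).trans (hφX.le.trans hxδ)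
    have hd := hdiag m hm0 hmx
    have hR : 0 ≤ (3 + 6 * ℓ) * B * S := by positivity
    have hτ : c * ((X - Y) / 2) ≤ δ := by nlinarith
    have tr' := mul_le_mul_of_nonneg_left tr hc.le
    have tr'' := mul_le_mul_of_nonneg_left hτ hR
    have key := abs_sub_abs_le_abs_sub (σ x * K1 x y + σ y * K2 x y)
      (σ m * K1 m m + σ m * K2 m m)
    rw [abs_sub_comm] at key
    have := mul_le_mul_of_nonneg_left key hc.le
    linarith
  have hbot : ∀ x, 0 < x → x ≤ δ → c * |σ 0 * K2 x 0| ≤ 2 * B * δ * S := by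
    intro x hx hxδ
    have hS : 0 ≤ S := (abs_nonneg _).trans (hB x 0 le_rfl hx hxδ).1
    refine le_of_mul (hcσ 0) ?_
    have e : σ 0 * (σ 0 * K2 x 0) = -(a1 0 * K x 0) := by
      linear_combination K2 x 0 * hσ2 0 ⟨le_rfl, hℓ.le⟩ + h.bottom x ⟨hx, hxδ.trans_lt hδ⟩
    rw [e, abs_neg, abs_mul]
    calc |a1 0| * |K x 0| ≤ B * (2 * δ * S) := by
          refine mul_le_mul (ha1 0 ⟨le_rfl, hℓ.le⟩) ?_ (abs_nonneg _) hB0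
          refine (h.abs_kernel_le hδ hB le_rfl hx.le hxδ).trans ?_
          gcongr
      _ = 2 * B * δ * S := by ring
  have hminus : ∀ x y, 0 ≤ y → y < x → x ≤ δ →
      c * |σ x * K1 x y - σ y * K2 x y| ≤ M / 2 + (11 + 12 * ℓ) * B * δ * S := by
    intro x y hy hyx hxδ
    have hS : 0 ≤ S := (abs_nonneg _).trans (hB x y hy hyx hxδ).1
    have hx : 0 < x := hy.trans_lt hyx
    have hY := hsnn hy
    have hYX : φ.symm y < φ.symm x := φ.symm.strictMono hyx
    have ht := htime hx.le hxδ
    set X := φ.symm x with hX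
    set Y := φ.symm y with hY'
    have hφX : φ X = x := φ.apply_symm_apply x
    have hφY : φ Y = y := φ.apply_symm_apply y
    have tr := h.abs_transport_le ha1 ha2 hp hq hδ hB hσ hσa hφ hφ0 (ε := -1) (X := X) (Y := Y)
      (τ := Y) (by norm_num) hY (by rwa [hφX])
      (fun t ht => ⟨by linarith [ht.2], by linarith [ht.2]⟩)
      (fun t ht => ⟨by linarith [ht.2], by linarith [ht.2]⟩)
    rw [show Y + -1 * Y = 0 by ring, hφX, hφY, hφ0] at tr
    set z := φ (X - Y)
    have hz0 : 0 < z := by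
      rw [← hφ0]; exact φ.strictMono (by linarith)
    have hzx : z ≤ δ := (φ.monotone (by linarith : X - Y ≤ X)).trans (hφX.le.trans hxδ)
    have h1 := hplus z 0 le_rfl hz0 hzx
    have h2 := hbot z hz0 hzx
    have hR : 0 ≤ (3 + 6 * ℓ) * B * S := by positivity
    have hτ : c * Y ≤ δ := by nlinarith
    have tr' := mul_le_mul_of_nonneg_left tr hc.le
    have tr'' := mul_le_mul_of_nonneg_left hτ hR
    have k1 := abs_sub (σ z * K1 z 0 + σ 0 * K2 z 0) (2 * (σ 0 * K2 z 0))
    rw [abs_mul, abs_two, show σ z * K1 z 0 + σ 0 * K2 z 0 - 2 * (σ 0 * K2 z 0)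
      = σ z * K1 z 0 + -1 * (σ 0 * K2 z 0) by ring] at k1
    have k2 := abs_sub_abs_le_abs_sub (σ x * K1 x y + -1 * (σ y * K2 x y))
      (σ z * K1 z 0 + -1 * (σ 0 * K2 z 0))
    rw [abs_sub_comm] at k2
    have k3 := mul_le_mul_of_nonneg_left k1 hc.le
    have k4 := mul_le_mul_of_nonneg_left k2 hc.le
    rw [show σ x * K1 x y - σ y * K2 x y = σ x * K1 x y + -1 * (σ y * K2 x y) by ring]
    linarith
  intro x y hy hyx hxδ
  have hS : 0 ≤ S := (abs_nonneg _).trans (hB x y hy hyx hxδ).1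
  have hδ0 : 0 ≤ δ := (hy.trans hyx.le).trans hxδ
  have h1 := hplus x y hy hyx hxδ
  have h2 := hminus x y hy hyx hxδ
  have h3 : 0 ≤ B * δ * S := by positivity
  have h4 : 0 ≤ ℓ * (B * δ * S) := by positivity
  have a1' := abs_add_le (σ x * K1 x y + σ y * K2 x y) (σ x * K1 x y - σ y * K2 x y)
  have a2' := abs_sub (σ x * K1 x y + σ y * K2 x y) (σ x * K1 x y - σ y * K2 x y)
  rw [show σ x * K1 x y + σ y * K2 x y + (σ x * K1 x y - σ y * K2 x y) = 2 * (σ x * K1 x y) by ring,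
    abs_mul, abs_two] at a1'
  rw [show σ x * K1 x y + σ y * K2 x y - (σ x * K1 x y - σ y * K2 x y) = 2 * (σ y * K2 x y) by ring,
    abs_mul, abs_two] at a2'
  have b1 := mul_le_mul_of_nonneg_left a1' hc.le
  have b2 := mul_le_mul_of_nonneg_left a2' hc.le
  have c1 := mul_le_mul_of_nonneg_left (le_of_mul (u := K1 x y) (hcσ x) le_rfl) hc.le
  have c2 := mul_le_mul_of_nonneg_left (le_of_mul (u := K2 x y) (hcσ y) le_rfl) hc.le
  constructor <;> rw [le_div_iff₀ (by positivity)] <;> linarith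

theorem GoursatData.exists_gradientBound (h : GoursatData ℓ a a1 a2 p q K K1 K2 K11 K12 K22)
    {δ : ℝ} (hδ : δ ≤ ℓ) : ∃ S, GradientBound K1 K2 δ S := by
  obtain ⟨S1, h1⟩ := (isCompact_closedTriangle ℓ).exists_bound_of_continuousOn h.K1_cont
  obtain ⟨S2, h2⟩ := (isCompact_closedTriangle ℓ).exists_bound_of_continuousOn h.K2_cont
  refine ⟨max S1 S2, fun x y hy hyx hxδ => ?_⟩
  have hz : (x, y) ∈ closedTriangle ℓ := ⟨hy, hyx.le, hxδ.trans hδ⟩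
  exact ⟨(h1 _ hz).trans (le_max_left _ _), (h2 _ hz).trans (le_max_right _ _)⟩

/-- On short intervals the gradient of the kernel is controlled by `q - p`, with a sharp leading
constant. -/
theorem GoursatData.gradientBound_of_abs_sub_le
    (h : GoursatData ℓ a a1 a2 p q K K1 K2 K11 K12 K22) {c : ℝ} (hc : 0 < c)
    (hca : ∀ x ∈ Icc 0 ℓ, c ^ 2 ≤ a x) :
    ∃ D δ₀, 0 ≤ D ∧ 0 < δ₀ ∧ ∀ δ M, 0 < δ → δ ≤ δ₀ → δ < ℓ → (∀ x ∈ Ioc 0 δ, |q x - p x| ≤ M) →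
      GradientBound K1 K2 δ (M / (2 * c ^ 2) + D * δ * M) := by
  have hℓ := h.pos
  have hclamp : ∀ x, max 0 (min x ℓ) ∈ Icc 0 ℓ := fun x =>
    ⟨le_max_left _ _, max_le hℓ.le (min_le_right _ _)⟩
  obtain ⟨A, hA⟩ := isCompact_Icc.exists_bound_of_continuousOn h.a_cont
  obtain ⟨B1, hB1⟩ := isCompact_Icc.exists_bound_of_continuousOn h.a1_cont
  obtain ⟨B2, hB2⟩ := isCompact_Icc.exists_bound_of_continuousOn h.a2_cont
  obtain ⟨B3, hB3⟩ := isCompact_Icc.exists_bound_of_continuousOn h.p_cont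
  obtain ⟨B4, hB4⟩ := isCompact_Icc.exists_bound_of_continuousOn h.q_cont
  set B := max (max B1 B2) (max B3 B4)
  have hB0 : 0 ≤ B := (norm_nonneg _).trans
    ((hB1 0 ⟨le_rfl, hℓ.le⟩).trans ((le_max_left _ _).trans (le_max_left _ _)))
  let σ : ℝ → ℝ := fun x => √(a (max 0 (min x ℓ)))
  have hσ : Continuous σ := Real.continuous_sqrt.comp
    (h.a_cont.comp_continuous (by fun_prop) hclamp)
  have hσa : ∀ x ∈ Icc 0 ℓ, σ x = √(a x) := fun x hx => by
    simp only [σ, min_eq_left hx.2, max_eq_right hx.1]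
  have hcσ : ∀ x, c ≤ σ x := fun x => Real.le_sqrt_of_sq_le (hca _ (hclamp x))
  obtain ⟨φ, hφ0, hφ⟩ := exists_orderIso_hasDerivAt hσ hc hcσ (C := √A)
    fun x => Real.sqrt_le_sqrt ((le_abs_self _).trans (hA _ (hclamp x)))
  set E := (11 + 12 * ℓ) * B with hE
  have hE0 : 0 ≤ E := by positivity
  refine ⟨E / c ^ 4, c ^ 2 / (2 * (E + 1)), by positivity, by positivity,
    fun δ M hδ hδ₀ hδℓ hM => ?_⟩
  have improve : ∀ S, GradientBound K1 K2 δ S →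
      GradientBound K1 K2 δ ((M / 2 + E * δ * S) / c ^ 2) := fun S hS =>
    h.gradientBound_improve
      (fun x hx => (hB1 x hx).trans ((le_max_left _ _).trans (le_max_left _ _)))
      (fun x hx => (hB2 x hx).trans ((le_max_right _ _).trans (le_max_left _ _)))
      (fun x hx => (hB3 x hx).trans ((le_max_left _ _).trans (le_max_right _ _)))
      (fun x hx => (hB4 x hx).trans ((le_max_right _ _).trans (le_max_right _ _)))
      hδℓ hS hσ hσa hφ hφ0 hc hcσ hM
  let T := {S | GradientBound K1 K2 δ S}
  have hT : T.Nonempty := h.exists_gradientBound hδℓ.le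
  have hTnn : ∀ S ∈ T, 0 ≤ S := fun S hS => (abs_nonneg _).trans (hS δ 0 le_rfl hδ le_rfl).1
  have hmem : GradientBound K1 K2 δ (sInf T) := fun x y hy hyx hxδ =>
    ⟨le_csInf hT fun S hS => (hS x y hy hyx hxδ).1, le_csInf hT fun S hS => (hS x y hy hyx hxδ).2⟩
  have hle : sInf T ≤ (M / 2 + E * δ * sInf T) / c ^ 2 := csInf_le ⟨0, hTnn⟩ (improve _ hmem)
  have hs0 : 0 ≤ sInf T := hTnn _ hmem
  have hc2 : 0 < c ^ 2 := by positivity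
  have hEδ : E * δ ≤ c ^ 2 / 2 := by
    rw [le_div_iff₀ (by positivity)] at hδ₀
    nlinarith
  have hfin : sInf T ≤ M / c ^ 2 := by
    rw [le_div_iff₀ hc2] at hle ⊢
    nlinarith
  have key := improve _ hmem
  refine fun x y hy hyx hxδ => ?_
  have hb : (M / 2 + E * δ * sInf T) / c ^ 2 ≤ M / (2 * c ^ 2) + E / c ^ 4 * δ * M := by
    calc (M / 2 + E * δ * sInf T) / c ^ 2 ≤ (M / 2 + E * δ * (M / c ^ 2)) / c ^ 2 := by gcongr
      _ = _ := by field_simp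
  exact ⟨(key x y hy hyx hxδ).1.trans hb, (key x y hy hyx hxδ).2.trans hb⟩

end Estimates

theorem closedTriangle_subset {ℓ ℓ' : ℝ} (h : ℓ' ≤ ℓ) : closedTriangle ℓ' ⊆ closedTriangle ℓ :=
  fun _ hz => ⟨hz.1, hz.2.1, hz.2.2.trans h⟩

theorem GoursatData.mono {ℓ ℓ' : ℝ} {a a1 a2 p q : ℝ → ℝ} {K K1 K2 K11 K12 K22 : ℝ → ℝ → ℝ}
    (h : GoursatData ℓ a a1 a2 p q K K1 K2 K11 K12 K22) (h0 : 0 < ℓ') (hle : ℓ' ≤ ℓ) :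
    GoursatData ℓ' a a1 a2 p q K K1 K2 K11 K12 K22 where
  pos := h0
  a_cont := h.a_cont.mono (Icc_subset_Icc_right hle)
  a1_cont := h.a1_cont.mono (Icc_subset_Icc_right hle)
  a2_cont := h.a2_cont.mono (Icc_subset_Icc_right hle)
  p_cont := h.p_cont.mono (Icc_subset_Icc_right hle)
  q_cont := h.q_cont.mono (Icc_subset_Icc_right hle)
  a_pos x hx := h.a_pos x (Icc_subset_Icc_right hle hx)
  a_deriv x hx := h.a_deriv x (Ioo_subset_Ioo_right hle hx)
  a1_deriv x hx := h.a1_deriv x (Ioo_subset_Ioo_right hle hx)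
  K_cont := h.K_cont.mono (closedTriangle_subset hle)
  K1_cont := h.K1_cont.mono (closedTriangle_subset hle)
  K2_cont := h.K2_cont.mono (closedTriangle_subset hle)
  K11_cont := h.K11_cont.mono (closedTriangle_subset hle)
  K_fderiv x y hy hyx hx := h.K_fderiv x y hy hyx (hx.trans_le hle)
  K1_fderiv x y hy hyx hx := h.K1_fderiv x y hy hyx (hx.trans_le hle)
  K2_fderiv x y hy hyx hx := h.K2_fderiv x y hy hyx (hx.trans_le hle)
  bottom_deriv x hx := h.bottom_deriv x (Ioo_subset_Ioo_right hle hx)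
  diag_deriv x hx := h.diag_deriv x (Ioo_subset_Ioo_right hle hx)
  pde x y hy hyx hx := h.pde x y hy hyx (hx.trans_le hle)
  bottom x hx := h.bottom x (Ioo_subset_Ioo_right hle hx)
  diag x hx := h.diag x (Ioo_subset_Ioo_right hle hx)
  zero := h.zero

theorem exists_pos_forall_Icc_lt {ℓ : ℝ} (hℓ : 0 < ℓ) {f : ℝ → ℝ} (hf : ContinuousOn f (Icc 0 ℓ))
    {c : ℝ} (hc : c < f 0) : ∃ d, 0 < d ∧ d ≤ ℓ ∧ ∀ x ∈ Icc 0 d, c < f x := by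
  have h1 : ∀ᶠ x in 𝓝[Icc 0 ℓ] 0, c < f x :=
    (hf 0 ⟨le_rfl, hℓ.le⟩).eventually (lt_mem_nhds hc)
  rw [nhdsWithin_Icc_eq_nhdsGE hℓ] at h1
  obtain ⟨u, hu, hus⟩ := (mem_nhdsGE_iff_exists_Icc_subset).1 h1
  exact ⟨min u ℓ, lt_min hu hℓ, min_le_right _ _,
    fun x hx => hus ⟨hx.1, hx.2.trans (min_le_left _ _)⟩⟩

/-- A bound that improves by a fixed factor forces vanishing. -/
theorem eq_zero_of_abs_le_imp {s : Set ℝ} {f : ℝ → ℝ} {θ M₀ : ℝ} (hθ : θ < 1)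
    (h0 : ∀ x ∈ s, |f x| ≤ M₀)
    (h : ∀ M, (∀ x ∈ s, |f x| ≤ M) → ∀ x ∈ s, |f x| ≤ θ * M) : ∀ x ∈ s, f x = 0 := by
  intro x hx
  let T := {M | ∀ x ∈ s, |f x| ≤ M}
  have hT : T.Nonempty := ⟨M₀, h0⟩
  have hnn : ∀ M ∈ T, 0 ≤ M := fun M hM => (abs_nonneg _).trans (hM x hx)
  have hmem : sInf T ∈ T := fun y hy => le_csInf hT fun M hM => hM y hy
  have hle : sInf T ≤ θ * sInf T := csInf_le ⟨0, hnn⟩ (h _ hmem)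
  have hs : sInf T ≤ 0 := by nlinarith [hnn _ hmem]
  exact abs_nonpos_iff.1 ((hmem x hx).trans hs)

theorem GoursatData.exists_eq_of_integral_eq_zero {ℓ : ℝ} {a a1 a2 p q : ℝ → ℝ}
    {K K1 K2 K11 K12 K22 : ℝ → ℝ → ℝ} (h : GoursatData ℓ a a1 a2 p q K K1 K2 K11 K12 K22)
    {c : ℝ} (hc : 0 < c) (hca : ∀ x ∈ Icc 0 ℓ, c ^ 2 ≤ a x) (ha0 : a 0 = 4 / 3 * c ^ 2)
    {bt bt1 bt2 : ℝ → ℂ} (hbt : ContinuousOn bt (Icc 0 ℓ)) (hbt1 : ContinuousOn bt1 (Icc 0 ℓ))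
    (hbt2 : ContinuousOn bt2 (Icc 0 ℓ)) (dbt : ∀ x ∈ Ioo 0 ℓ, HasDerivAt bt (bt1 x) x)
    (dbt1 : ∀ x ∈ Ioo 0 ℓ, HasDerivAt bt1 (bt2 x) x) (hbt0 : bt 0 ≠ 0)
    (hlow : ∀ x ∈ Icc 0 ℓ, 5 / 6 * ‖bt 0‖ ≤ ‖bt x‖)
    (hker : ∀ x ∈ Ioo 0 ℓ, ∫ y in (0:ℝ)..x, (K x y : ℂ) * (y * bt y) = 0) :
    ∃ ε, 0 < ε ∧ ε < ℓ ∧ ∀ x ∈ Icc 0 ε, p x = q x := by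
  have hℓ := h.pos
  have hid : Continuous fun x : ℝ => (x : ℂ) := Complex.continuous_ofReal
  have did : ∀ x : ℝ, HasDerivAt (fun x : ℝ => (x : ℂ)) 1 x := fun x =>
    Complex.ofRealCLM.hasDerivAt
  have hb : ContinuousOn (fun x : ℝ => (x : ℂ) * bt x) (Icc 0 ℓ) := hid.continuousOn.mul hbt
  have hb2 : ContinuousOn (fun x : ℝ => 2 * bt1 x + x * bt2 x) (Icc 0 ℓ) :=
    (hbt1.const_smul (2:ℂ)).add (hid.continuousOn.mul hbt2)
  have moment := fun x (hx : x ∈ Ioo 0 ℓ) => h.moment_identity hb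
    (b1 := fun x => bt x + x * bt1 x) (hbt.add (hid.continuousOn.mul hbt1)) hb2
    (fun x hx => by convert! (did x).mul (dbt x hx) using 1; ring)
    (fun x hx => by convert! (dbt x hx).add ((did x).mul (dbt1 x hx)) using 1; ring)
    (by simp) hker hx
  obtain ⟨N, hN⟩ := isCompact_Icc.exists_bound_of_continuousOn
    (((hid.comp_continuousOn h.a_cont).mul hb2).sub ((hid.comp_continuousOn h.p_cont).mul hb))
  obtain ⟨M₀, hM₀⟩ := isCompact_Icc.exists_bound_of_continuousOn (h.q_cont.sub h.p_cont)
  have hN0 : 0 ≤ N := (norm_nonneg _).trans (hN 0 ⟨le_rfl, hℓ.le⟩)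
  obtain ⟨D, δ₀, hD, hδ₀, hgrad⟩ := h.gradientBound_of_abs_sub_le hc hca
  have hβ : 0 < ‖bt 0‖ := norm_pos_iff.2 hbt0
  set β := ‖bt 0‖ with hβdef
  have ha0pos : 0 < a 0 := by rw [ha0]; positivity
  -- the smallness condition on the interval
  obtain ⟨δ, hδ, hδδ₀, hδℓ, hδs⟩ : ∃ δ, 0 < δ ∧ δ ≤ δ₀ ∧ δ < ℓ ∧
      (a 0 * β * D + (1 / c ^ 2 + 2 * D * ℓ) * N) * δ ≤ β / 12 := by
    set W := a 0 * β * D + (1 / c ^ 2 + 2 * D * ℓ) * N with hW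
    have hW0 : 0 ≤ W := by positivity
    refine ⟨min (min δ₀ (ℓ / 2)) (β / (12 * (W + 1))), by positivity,
      (min_le_left _ _).trans (min_le_left _ _),
      ((min_le_left _ _).trans (min_le_right _ _)).trans_lt (by linarith), ?_⟩
    calc W * _ ≤ W * (β / (12 * (W + 1))) := by gcongr; exact min_le_right _ _
      _ = β / 12 * (W / (W + 1)) := by field_simp
      _ ≤ β / 12 * 1 := by
        gcongr
        rw [div_le_one (by positivity)]
        linarith
      _ = β / 12 := mul_one _
  have hzero : ∀ x ∈ Ioc 0 δ, q x - p x = 0 := by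
    refine eq_zero_of_abs_le_imp (θ := 9 / 10) (M₀ := M₀) (by norm_num)
      (fun x hx => hM₀ x ⟨hx.1.le, hx.2.trans hδℓ.le⟩) fun M hM x hx => ?_
    have hM0 : 0 ≤ M := (abs_nonneg _).trans (hM x hx)
    have hB := hgrad δ M hδ hδδ₀ hδℓ hM
    set S := M / (2 * c ^ 2) + D * δ * M with hS
    have hx0 : 0 < x := hx.1
    have hK0 : |K x 0| ≤ S * x := h.abs_bottom_le hδℓ.le hx0.le hx.2
      fun s hs => (hB s 0 le_rfl hs.1 (hs.2.le.trans hx.2)).1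
    have hint : ‖∫ y in (0:ℝ)..x, (K x y : ℂ) *
        (a y * (2 * bt1 y + y * bt2 y) - p y * (y * bt y))‖ ≤ 2 * x * S * N * |x - 0| := by
      refine norm_integral_le_of_norm_le_const fun y hy => ?_
      rw [uIoc_of_le hx0.le] at hy
      rw [norm_mul, Complex.norm_real]
      exact mul_le_mul (h.abs_kernel_le hδℓ hB hy.1.le hy.2 hx.2)
        (hN y ⟨hy.1.le, hy.2.trans (hx.2.trans hδℓ.le)⟩) (norm_nonneg _) (by positivity)
    rw [sub_zero, abs_of_pos hx0] at hint
    have hm := moment x ⟨hx0, hx.2.trans_lt hδℓ⟩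
    simp only [Complex.ofReal_zero, zero_mul, add_zero] at hm
    set I := ∫ y in (0:ℝ)..x, (K x y : ℂ) * (a y * (2 * bt1 y + y * bt2 y) - p y * (y * bt y))
    have heq : ((q x - p x : ℝ) : ℂ) * (x * bt x) = -((a 0 : ℂ) * K x 0 * bt 0 + I) := by
      push_cast
      linear_combination hm
    have hnorm := congrArg norm heq
    rw [norm_neg, norm_mul, norm_mul, Complex.norm_real, Complex.norm_real, Real.norm_eq_abs,
      Real.norm_eq_abs, abs_of_pos hx0] at hnorm
    have htri := norm_add_le ((a 0 : ℂ) * K x 0 * bt 0) I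
    rw [norm_mul, norm_mul, Complex.norm_real, Complex.norm_real, Real.norm_eq_abs,
      Real.norm_eq_abs, abs_of_pos ha0pos, ← hβdef] at htri
    have hg : |q x - p x| * ‖bt x‖ ≤ a 0 * S * β + 2 * S * N * x := by
      refine le_of_mul_le_mul_right ?_ hx0
      calc |q x - p x| * ‖bt x‖ * x = |q x - p x| * (x * ‖bt x‖) := by ring
        _ ≤ a 0 * |K x 0| * β + 2 * x * S * N * x := by rw [hnorm]; linarith
        _ ≤ a 0 * (S * x) * β + 2 * x * S * N * x := by gcongr
        _ = _ := by ring
    have hS0 : 0 ≤ S := by positivity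
    have hSN : 2 * S * N * x ≤ (1 / c ^ 2 + 2 * D * ℓ) * N * δ * M := by
      calc 2 * S * N * x ≤ 2 * (M / (2 * c ^ 2) + D * ℓ * M) * N * δ := by
            have : S ≤ M / (2 * c ^ 2) + D * ℓ * M := by rw [hS]; gcongr
            gcongr
            exact hx.2
        _ = _ := by field_simp
    have haS : a 0 * S * β = 2 / 3 * β * M + a 0 * β * D * δ * M := by
      have : a 0 * (M / (2 * c ^ 2)) = 2 / 3 * M := by
        rw [ha0]; field_simp; ring
      rw [hS]
      linear_combination β * this
    have hlx := mul_le_mul_of_nonneg_left (hlow x ⟨hx0.le, hx.2.trans hδℓ.le⟩)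
      (abs_nonneg (q x - p x))
    have hδM := mul_le_mul_of_nonneg_right hδs hM0
    refine le_of_mul_le_mul_right ?_ hβ
    nlinarith
  refine ⟨δ, hδ, hδℓ, fun x hx => ?_⟩
  have hcl : x ∈ closure (Ioo 0 δ) := by rwa [closure_Ioo hδ.ne]
  have hsub : Icc 0 δ ⊆ Icc 0 ℓ := Icc_subset_Icc_right hδℓ.le
  refine EqOn.of_subset_closure (s := Ioo 0 δ) (t := Icc 0 δ)
    (fun y hy => (sub_eq_zero.1 (hzero y ⟨hy.1, hy.2.le⟩)).symm) (h.p_cont.mono hsub)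
    (h.q_cont.mono hsub) Ioo_subset_Icc_self (closure_Ioo hδ.ne).ge hx

/-- The local uniqueness step ((2.11)–(2.16)): if the kernel `K` annihilates
`b(x) = x·b̃(x)` with `b̃` non-vanishing near `0`, then `p = q` near `0`. -/
theorem stmt_10
    (ℓ : ℝ) (hℓ : 0 < ℓ)
    (p q a : ℝ → ℝ)
    (hp : ContDiffOn ℝ 1 p (Icc 0 ℓ)) (hq : ContDiffOn ℝ 1 q (Icc 0 ℓ))
    (ha : ContDiffOn ℝ 2 a (Icc 0 ℓ)) (hapos : ∀ x ∈ Icc (0:ℝ) ℓ, 0 < a x)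
    (K : ℝ → ℝ → ℝ) (hK : IsGoursatSol ℓ a p q K)
    (b bt : ℝ → ℂ) (hb : b = fun x : ℝ => (x : ℂ) * bt x)
    (hbt : ContDiffOn ℝ 2 bt (Icc 0 ℓ))
    (κ : ℝ) (hκ : 0 < κ) (r : ℝ) (hr : r ∈ Ioc (0:ℝ) ℓ)
    (hbtlb : ∀ x ∈ Icc (0:ℝ) r, κ ≤ ‖bt x‖)
    (hker : ∀ x ∈ Icc (0:ℝ) ℓ, (∫ y in (0:ℝ)..x, (K x y : ℂ) * b y) = 0) :
    ∃ ε : ℝ, 0 < ε ∧ ε < ℓ ∧ ∀ x ∈ Icc (0:ℝ) ε, p x = q x := by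
  obtain ⟨a1, a2, K1, K2, K11, K12, K22, h⟩ := hK.exists_goursatData hℓ hp hq ha hapos
  subst hb
  have hu := uniqueDiffOn_Icc hℓ
  have hbt1 : ContDiffOn ℝ 1 (derivWithin bt (Icc 0 ℓ)) (Icc 0 ℓ) :=
    hbt.derivWithin hu (by norm_num)
  have hbt2 : ContinuousOn (derivWithin (derivWithin bt (Icc 0 ℓ)) (Icc 0 ℓ)) (Icc 0 ℓ) :=
    hbt1.continuousOn_derivWithin hu le_rfl
  have ha0 : 0 < a 0 := hapos 0 ⟨le_rfl, hℓ.le⟩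
  have hb0 : 0 < ‖bt 0‖ := hκ.trans_le (hbtlb 0 ⟨le_rfl, hr.1.le⟩)
  obtain ⟨d, hd, hdℓ, had⟩ := exists_pos_forall_Icc_lt hℓ ha.continuousOn
    (show 3 / 4 * a 0 < a 0 by linarith)
  obtain ⟨e, he, _, hbe⟩ := exists_pos_forall_Icc_lt hℓ hbt.continuousOn.norm
    (show 5 / 6 * ‖bt 0‖ < ‖bt 0‖ by linarith)
  have hm : min d e ≤ ℓ := (min_le_left _ _).trans hdℓ
  have hsub : Icc 0 (min d e) ⊆ Icc 0 ℓ := Icc_subset_Icc_right hm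
  have hsubo : Ioo 0 (min d e) ⊆ Ioo 0 ℓ := Ioo_subset_Ioo_right hm
  have hc2 : √(3 / 4 * a 0) ^ 2 = 3 / 4 * a 0 := Real.sq_sqrt (by positivity)
  obtain ⟨ε, hε, hεm, hpq⟩ := (h.mono (lt_min hd he) hm).exists_eq_of_integral_eq_zero
    (c := √(3 / 4 * a 0)) (by positivity)
    (fun x hx => hc2.trans_le (had x ⟨hx.1, hx.2.trans (min_le_left _ _)⟩).le)
    (by rw [hc2]; ring) (hbt.continuousOn.mono hsub) (hbt1.continuousOn.mono hsub)
    (hbt2.mono hsub)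
    (fun x hx => hasDerivAt_derivWithin_Icc (hbt.differentiableOn (by norm_num)) (hsubo hx))
    (fun x hx => hasDerivAt_derivWithin_Icc (hbt1.differentiableOn (by norm_num)) (hsubo hx))
    (norm_pos_iff.1 hb0)
    (fun x hx => (hbe x ⟨hx.1, hx.2.trans (min_le_right _ _)⟩).le)
    (fun x hx => hker x (hsub (Ioo_subset_Icc_self hx)))
  exact ⟨ε, hε, hεm.trans_le hm, hpq⟩
end
end

section
/- Let σ ∈ ℂ\{0}, p, q ∈ C¹([0,ℓ];ℝ), a ∈ C²([0,ℓ];ℝ) with a > 0 on [0,ℓ], and let K ∈ C²(closure Ω;ℝ) solve the Goursat problem associated with (a,p,q). Suppose u, ũ ∈ C^{1,2}([0,T]×[0,ℓ];ℂ) satisfy σ∂_t u = a(x)∂_x²u − p(x)u and σ∂_t ũ = a(x)∂_x²ũ − q(x)ũ in (0,T)×(0,ℓ), u(0,·) = ũ(0,·) = b on (0,ℓ) for some b ∈ C([0,ℓ];ℂ), u(t,0) = ũ(t,0) for 0<t<T, and ∂_x u(t,0) = ∂_x ũ(t,0) = 0 for 0<t<T. Then ∫₀ˣ K(x,y) b(y)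 dy = 0 for all x ∈ [0,ℓ]. -/
open Set MeasureTheory intervalIntegral

noncomputable section

/-- `u` is of class `C^{1,2}` on `[0,T] × [0,ℓ]`, with `ut`, `ux`, `uxx` its
partial derivatives `∂ₜu`, `∂ₓu`, `∂ₓ²u`. -/
def IsC12 (T ℓ : ℝ) (u ut ux uxx : ℝ → ℝ → ℂ) : Prop :=
  (∀ t ∈ Icc (0:ℝ) T, ∀ x ∈ Icc (0:ℝ) ℓ,
      HasDerivWithinAt (fun s => u s x) (ut t x) (Icc 0 T) t ∧
      HasDerivWithinAt (fun y => u t y) (ux t x) (Icc 0 ℓ) x ∧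
      HasDerivWithinAt (fun y => ux t y) (uxx t x) (Icc 0 ℓ) x) ∧
  ContinuousOn (fun z : ℝ × ℝ => u z.1 z.2) (Icc 0 T ×ˢ Icc 0 ℓ) ∧
  ContinuousOn (fun z : ℝ × ℝ => ut z.1 z.2) (Icc 0 T ×ˢ Icc 0 ℓ) ∧
  ContinuousOn (fun z : ℝ × ℝ => ux z.1 z.2) (Icc 0 T ×ˢ Icc 0 ℓ) ∧
  ContinuousOn (fun z : ℝ × ℝ => uxx z.1 z.2) (Icc 0 T ×ˢ Icc 0 ℓ)

/-- Every complex number outside the cone `‖z‖ ≤ 2 * re z` is `(1 + I) * w ^ 3` for some `w` in the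
closed first quadrant. -/
theorem exists_cube_in_quadrant_of_not_cone {z : ℂ} (hz : ¬ ‖z‖ ≤ 2 * z.re) :
    ∃ w : ℂ, 0 ≤ w.re ∧ 0 ≤ w.im ∧ z = (1 + Complex.I) * w ^ 3 := by
  have h1I : (1 + Complex.I) ≠ 0 := fun h => by simpa using congrArg Complex.re h
  obtain ⟨v, rfl⟩ : ∃ v, z = (1 + Complex.I) * v := ⟨z / (1 + Complex.I), by field_simp⟩
  have hv0 : v ≠ 0 := by rintro rfl; simp at hz
  suffices ∃ s : ℂ, 0 ≤ s.im ∧ s.im ≤ 3 * Real.pi / 2 ∧ Complex.exp s = v by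
    obtain ⟨s, hs0, hs1, hs⟩ := this
    have him : (s / 3).im = s.im / 3 := by
      rw [show s / 3 = s / ((3 : ℝ) : ℂ) by simp, Complex.div_ofReal_im]
    refine ⟨Complex.exp (s / 3), ?_, ?_, ?_⟩
    · rw [Complex.exp_re, him]
      exact mul_nonneg (Real.exp_pos _).le
        (Real.cos_nonneg_of_mem_Icc ⟨by linarith [Real.pi_pos], by linarith⟩)
    · rw [Complex.exp_im, him]
      exact mul_nonneg (Real.exp_pos _).le
        (Real.sin_nonneg_of_mem_Icc ⟨by linarith, by linarith [Real.pi_pos]⟩)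
    · rw [← Complex.exp_nat_mul, ← hs]
      congr 2
      push_cast
      ring
  by_cases him : 0 ≤ v.im
  · refine ⟨Complex.log v, ?_, ?_, Complex.exp_log hv0⟩
    · simpa [Complex.log_im, Complex.arg_nonneg_iff] using him
    · rw [Complex.log_im]
      linarith [Complex.arg_le_pi v, Real.pi_pos]
  · push Not at him
    have hre : v.re ≤ 0 := by
      by_contra! hre
      apply hz
      have h1 : ‖(1 : ℂ) + Complex.I‖ ≤ 2 :=
        (norm_add_le _ _).trans (by rw [norm_one, Complex.norm_I]; norm_num)
      have h2 := Complex.norm_le_abs_re_add_abs_im v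
      rw [abs_of_pos hre, abs_of_neg him] at h2
      rw [norm_mul]
      have h3 : ((1 + Complex.I) * v).re = v.re - v.im := by simp [Complex.mul_re]
      rw [h3]
      nlinarith [norm_nonneg v]
    refine ⟨Complex.log v + 2 * Real.pi * Complex.I, ?_, ?_, ?_⟩
    · simp [Complex.log_im]
      linarith [Complex.neg_pi_lt_arg v, Real.pi_pos]
    · have h4 : Complex.arg v ≤ -(Real.pi / 2) := by
        by_contra! h
        rcases hre.lt_or_eq with h5 | h5
        · have := Complex.abs_arg_le_pi_div_two_iff.1
            (abs_le.2 ⟨h.le, by linarith [Real.pi_pos, Complex.arg_neg_iff.2 him]⟩)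
          linarith
        · have := Complex.arg_eq_neg_pi_div_two_iff.2 ⟨h5, him⟩
          rw [this] at h
          linarith
      simp [Complex.log_im]
      linarith
    · rw [Complex.exp_add, Complex.exp_two_pi_mul_I, mul_one, Complex.exp_log hv0]

/-- An entire function of order `1 / 2` that is bounded on the cone `‖z‖ ≤ 2 * re z` is constant. -/
theorem apply_eq_apply_of_order_half_of_bounded_on_cone {E : Type*} [NormedAddCommGroup E]
    [NormedSpace ℂ E] {f : ℂ → E} (hf : Differentiable ℂ f) {A k₀ k₁ C : ℝ} (hk₀ : 0 ≤ k₀)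
    (hk₁ : 0 ≤ k₁) (hgrowth : ∀ z, ‖f z‖ ≤ A * Real.exp √(k₀ + k₁ * ‖z‖))
    (hcone : ∀ z : ℂ, ‖z‖ ≤ 2 * z.re → ‖f z‖ ≤ C) (z w : ℂ) : f z = f w := by
  refine hf.apply_eq_apply_of_bounded ?_ z w
  rw [isBounded_iff_forall_norm_le]
  refine ⟨C, ?_⟩
  rintro _ ⟨z, rfl⟩
  by_cases hz : ‖z‖ ≤ 2 * z.re
  · exact hcone z hz
  obtain ⟨w, hre, him, rfl⟩ := exists_cube_in_quadrant_of_not_cone hz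
  have hn : ‖(1 : ℂ) + Complex.I‖ ≤ 2 :=
    (norm_add_le _ _).trans (by rw [norm_one, Complex.norm_I]; norm_num)
  have hA : 0 ≤ A := by
    have := (norm_nonneg _).trans (hgrowth 0)
    exact nonneg_of_mul_nonneg_left this (Real.exp_pos _)
  refine PhragmenLindelof.quadrant_I (f := fun w => f ((1 + Complex.I) * w ^ 3)) (C := C)
    (Differentiable.diffContOnCl (by fun_prop)) ⟨3 / 2, by norm_num, √(k₀ + k₁ * 2), ?_⟩ ?_ ?_
    hre him
  · refine Asymptotics.IsBigO.of_bound A ?_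
    have : ∀ᶠ w : ℂ in Bornology.cobounded ℂ, 1 ≤ ‖w‖ :=
      (tendsto_norm_cobounded_atTop (E := ℂ)).eventually_ge_atTop 1
    filter_upwards [Filter.mem_inf_of_left this] with w hw
    refine (hgrowth _).trans ?_
    rw [Real.norm_of_nonneg (Real.exp_pos _).le]
    gcongr
    apply Real.sqrt_le_iff.2
    refine ⟨by positivity, ?_⟩
    rw [mul_pow, Real.sq_sqrt (by positivity), ← Real.rpow_natCast, ← Real.rpow_mul (by positivity)]
    norm_num
    have h3 : 1 ≤ ‖w‖ ^ 3 := one_le_pow₀ hw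
    have h4 : 0 ≤ ‖w‖ ^ 3 := by positivity
    have h5 : k₁ * (‖(1 : ℂ) + Complex.I‖ * ‖w‖ ^ 3) ≤ k₁ * (2 * ‖w‖ ^ 3) := by gcongr
    nlinarith [mul_nonneg hk₀ (sub_nonneg.2 h3)]
  · intro x hx
    apply hcone
    rw [norm_mul]
    have : ((1 + Complex.I) * (x : ℂ) ^ 3).re = x ^ 3 := by
      rw [← Complex.ofReal_pow, Complex.re_mul_ofReal]; simp
    rw [this, norm_pow, Complex.norm_real, Real.norm_of_nonneg hx]
    gcongr
  · intro x hx
    apply hcone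
    rw [norm_mul]
    have : ((1 + Complex.I) * ((x : ℂ) * Complex.I) ^ 3).re = x ^ 3 := by
      have : (1 + Complex.I) * ((x : ℂ) * Complex.I) ^ 3 = (1 - Complex.I) * ((x ^ 3 : ℝ) : ℂ) := by
        push_cast
        linear_combination ((x : ℂ) ^ 3 * (Complex.I ^ 2 + Complex.I - 1)) * Complex.I_sq
      rw [this, Complex.re_mul_ofReal]; simp
    rw [this, norm_pow, norm_mul, Complex.norm_real, Real.norm_of_nonneg hx, Complex.norm_I,
      mul_one]
    gcongr

/-- If the norms of the powers of `x` have a summable majorant, then `1 - x` is invertible by its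
Neumann series. -/
theorem isUnit_one_sub_and_norm_inverse_le {A : Type*} [NormedRing A] [CompleteSpace A] {x : A}
    {b : ℕ → ℝ} {S : ℝ} (hb : HasSum b S) (hx : ∀ n, ‖x ^ n‖ ≤ b n) :
    IsUnit (1 - x) ∧ ‖Ring.inverse (1 - x)‖ ≤ S := by
  have h : Summable (x ^ ·) := hb.summable.of_norm_bounded hx
  let w : Aˣ := ⟨1 - x, _, h.one_sub_mul_tsum_pow, h.tsum_pow_mul_one_sub⟩
  refine ⟨⟨w, rfl⟩, ?_⟩
  have heq : Ring.inverse (1 - x) = ∑' n, x ^ n := Ring.inverse_unit w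
  rw [heq]
  exact tsum_of_norm_bounded hb hx

/-- The Volterra operator `f ↦ ∫₀ˣ f` on `C([0,ℓ]; ℂ)`. -/
def volterra {ℓ : ℝ} (hℓ : 0 ≤ ℓ) : C(Icc (0:ℝ) ℓ, ℂ) →L[ℂ] C(Icc (0:ℝ) ℓ, ℂ) :=
  LinearMap.mkContinuous
    { toFun := fun f => ⟨fun x => ∫ y in (0:ℝ)..x, IccExtend hℓ f y,
        (continuous_primitive (fun _ _ => f.continuous.Icc_extend'.intervalIntegrable _ _) 0).comp
          continuous_subtype_val⟩
      map_add' := fun f g => by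
        ext x
        exact integral_add (f.continuous.Icc_extend'.intervalIntegrable _ _)
          (g.continuous.Icc_extend'.intervalIntegrable _ _)
      map_smul' := fun c f => by
        ext x
        exact integral_const_mul c _ }
    ℓ (fun f => by
      refine (ContinuousMap.norm_le _ (by positivity)).2 fun x => ?_
      have := norm_integral_le_of_norm_le_const (a := (0:ℝ)) (b := x) (C := ‖f‖)
        (f := IccExtend hℓ f) (fun y _ => f.norm_coe_le_norm _)
      refine this.trans ?_
      rw [sub_zero, abs_of_nonneg x.2.1, mul_comm]
      exact mul_le_mul_of_nonneg_right x.2.2 (norm_nonneg _))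

theorem volterra_apply {ℓ : ℝ} (hℓ : 0 ≤ ℓ) (f : C(Icc (0:ℝ) ℓ, ℂ)) (x : Icc (0:ℝ) ℓ) :
    volterra hℓ f x = ∫ y in (0:ℝ)..x, IccExtend hℓ f y := rfl

theorem volterra_apply_of_eqOn {ℓ : ℝ} (hℓ : 0 ≤ ℓ) {f : C(Icc (0:ℝ) ℓ, ℂ)} {g : ℝ → ℂ}
    (hfg : ∀ (y : ℝ) (hy : y ∈ Icc 0 ℓ), f ⟨y, hy⟩ = g y) (x : Icc (0:ℝ) ℓ) :
    volterra hℓ f x = ∫ y in (0:ℝ)..x, g y := by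
  rw [volterra_apply]
  refine integral_congr fun y hy => ?_
  rw [uIcc_of_le x.2.1] at hy
  have hy' : y ∈ Icc 0 ℓ := ⟨hy.1, hy.2.trans x.2.2⟩
  simp only [IccExtend_of_mem hℓ f hy', hfg y hy']

theorem volterra_injective {ℓ : ℝ} (hℓ : 0 < ℓ) : Function.Injective (volterra hℓ.le) := by
  rw [injective_iff_map_eq_zero]
  intro f hf
  have hzero : ∀ x ∈ Ioo 0 ℓ, IccExtend hℓ.le f x = 0 := by
    intro x hx
    have hd := (f.continuous.Icc_extend' (h := hℓ.le)).integral_hasStrictDerivAt 0 x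
      |>.hasDerivAt
    have hev : (fun x => ∫ y in (0:ℝ)..x, IccExtend hℓ.le f y) =ᶠ[nhds x] fun _ => 0 := by
      filter_upwards [Ioo_mem_nhds hx.1 hx.2] with z hz
      have := DFunLike.congr_fun hf ⟨z, Ioo_subset_Icc_self hz⟩
      rwa [volterra_apply] at this
    exact hd.unique ((hasDerivAt_const x (0:ℂ)).congr_of_eventuallyEq hev)
  ext x
  have hx : (x : ℝ) ∈ closure (Ioo 0 ℓ) := by rw [closure_Ioo hℓ.ne]; exact x.2
  have := closure_minimal (s := Ioo 0 ℓ) (t := {x | IccExtend hℓ.le f x = 0}) hzero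
    (isClosed_singleton.preimage f.continuous.Icc_extend') hx
  simpa using this

theorem norm_volterra_apply_le {ℓ : ℝ} (hℓ : 0 ≤ ℓ) {f : C(Icc (0:ℝ) ℓ, ℂ)} {C : ℝ} {n : ℕ}
    (hf : ∀ x, ‖f x‖ ≤ C * ((x : ℝ) ^ n / n.factorial)) (x : Icc (0:ℝ) ℓ) :
    ‖volterra hℓ f x‖ ≤ C * ((x : ℝ) ^ (n + 1) / (n + 1).factorial) := by
  rw [volterra_apply]
  have hle : ∀ y ∈ Ioc (0:ℝ) x, ‖IccExtend hℓ f y‖ ≤ C * (y ^ n / n.factorial) := by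
    intro y hy
    have hy' : y ∈ Icc 0 ℓ := ⟨hy.1.le, hy.2.trans x.2.2⟩
    rw [IccExtend_of_mem hℓ f hy']
    exact hf ⟨y, hy'⟩
  refine (norm_integral_le_of_norm_le x.2.1 (Filter.Eventually.of_forall hle)
    (Continuous.intervalIntegrable (by fun_prop) _ _)).trans_eq ?_
  rw [intervalIntegral.integral_const_mul, intervalIntegral.integral_div, integral_pow,
    Nat.factorial_succ]
  push_cast
  have h1 : (n.factorial : ℝ) ≠ 0 := by positivity
  have h2 : (n + 1 : ℝ) ≠ 0 := by positivity
  field_simp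
  simp

/-- The operator `f ↦ ∫₀ˣ ∫₀ʸ c f` on `C([0,ℓ]; ℂ)`. -/
def volterraSq {ℓ : ℝ} (hℓ : 0 ≤ ℓ) (c : C(Icc (0:ℝ) ℓ, ℂ)) :
    C(Icc (0:ℝ) ℓ, ℂ) →L[ℂ] C(Icc (0:ℝ) ℓ, ℂ) :=
  volterra hℓ * volterra hℓ * ContinuousLinearMap.mul ℂ _ c

theorem volterraSq_apply {ℓ : ℝ} (hℓ : 0 ≤ ℓ) (c f : C(Icc (0:ℝ) ℓ, ℂ)) :
    volterraSq hℓ c f = volterra hℓ (volterra hℓ (c * f)) := rfl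

theorem norm_volterraSq_pow_apply_le {ℓ : ℝ} (hℓ : 0 ≤ ℓ) (c f : C(Icc (0:ℝ) ℓ, ℂ)) (n : ℕ)
    (x : Icc (0:ℝ) ℓ) :
    ‖(volterraSq hℓ c ^ n) f x‖ ≤ ‖c‖ ^ n * ‖f‖ * ((x : ℝ) ^ (2 * n) / (2 * n).factorial) := by
  induction n generalizing x with
  | zero => simpa using f.norm_coe_le_norm x
  | succ n ih =>
    rw [pow_succ']
    refine norm_volterra_apply_le hℓ (norm_volterra_apply_le hℓ fun y => ?_) x
    calc ‖c y * (volterraSq hℓ c ^ n) f y‖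
        ≤ ‖c‖ * (‖c‖ ^ n * ‖f‖ * ((y : ℝ) ^ (2 * n) / (2 * n).factorial)) := by
          rw [norm_mul]
          exact mul_le_mul (c.norm_coe_le_norm y) (ih y) (norm_nonneg _) (norm_nonneg _)
      _ = ‖c‖ ^ (n + 1) * ‖f‖ * ((y : ℝ) ^ (2 * n) / (2 * n).factorial) := by ring

theorem norm_volterraSq_pow_le {ℓ : ℝ} (hℓ : 0 ≤ ℓ) (c : C(Icc (0:ℝ) ℓ, ℂ)) (n : ℕ) :
    ‖volterraSq hℓ c ^ n‖ ≤ (ℓ * √‖c‖) ^ (2 * n) / (2 * n).factorial := by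
  refine ContinuousLinearMap.opNorm_le_bound _ (by positivity) fun f => ?_
  refine (ContinuousMap.norm_le _ (by positivity)).2 fun x => ?_
  refine (norm_volterraSq_pow_apply_le hℓ c f n x).trans ?_
  have h1 : (x : ℝ) ^ (2 * n) ≤ ℓ ^ (2 * n) := pow_le_pow_left₀ x.2.1 x.2.2 _
  rw [mul_pow, pow_mul √‖c‖, Real.sq_sqrt (norm_nonneg _)]
  calc ‖c‖ ^ n * ‖f‖ * ((x : ℝ) ^ (2 * n) / (2 * n).factorial)
      ≤ ‖c‖ ^ n * ‖f‖ * (ℓ ^ (2 * n) / (2 * n).factorial) := by gcongr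
    _ = _ := by ring

theorem isUnit_one_sub_volterraSq {ℓ : ℝ} (hℓ : 0 ≤ ℓ) (c : C(Icc (0:ℝ) ℓ, ℂ)) :
    IsUnit (1 - volterraSq hℓ c) :=
  (isUnit_one_sub_and_norm_inverse_le (A := C(Icc (0:ℝ) ℓ, ℂ) →L[ℂ] C(Icc (0:ℝ) ℓ, ℂ))
    (Real.hasSum_cosh _) (norm_volterraSq_pow_le hℓ c)).1

theorem norm_inverse_one_sub_volterraSq_le {ℓ : ℝ} (hℓ : 0 ≤ ℓ) (c : C(Icc (0:ℝ) ℓ, ℂ)) :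
    ‖Ring.inverse (1 - volterraSq hℓ c)‖ ≤ Real.exp (ℓ * √‖c‖) := by
  refine (isUnit_one_sub_and_norm_inverse_le
    (A := C(Icc (0:ℝ) ℓ, ℂ) →L[ℂ] C(Icc (0:ℝ) ℓ, ℂ)) (Real.hasSum_cosh _)
    (norm_volterraSq_pow_le hℓ c)).2.trans ?_
  rw [Real.cosh_eq]
  have : Real.exp (-(ℓ * √‖c‖)) ≤ Real.exp (ℓ * √‖c‖) :=
    Real.exp_le_exp.2 (by linarith [show 0 ≤ ℓ * √‖c‖ by positivity])
  linarith

theorem differentiable_inverse_one_sub_affine {A : Type*} [NormedRing A] [NormedAlgebra ℂ A]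
    [CompleteSpace A] {a b : A} (h : ∀ z : ℂ, IsUnit (1 - (a + z • b))) :
    Differentiable ℂ fun z : ℂ => Ring.inverse (1 - (a + z • b)) := by
  intro z
  have h1 : DifferentiableAt ℂ (fun z : ℂ => 1 - (a + z • b)) z := by fun_prop
  exact (differentiableAt_inverse (𝕜 := ℂ) (h z)).comp z h1

theorem volterraSq_add_smul {ℓ : ℝ} (hℓ : 0 ≤ ℓ) (c₀ c₁ : C(Icc (0:ℝ) ℓ, ℂ)) (z : ℂ) :
    volterraSq hℓ (c₀ + z • c₁) = volterraSq hℓ c₀ + z • volterraSq hℓ c₁ := by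
  refine ContinuousLinearMap.ext fun f => ?_
  change volterra hℓ (volterra hℓ ((c₀ + z • c₁) * f)) =
    volterra hℓ (volterra hℓ (c₀ * f)) + z • volterra hℓ (volterra hℓ (c₁ * f))
  rw [add_mul, smul_mul_assoc, map_add, map_add, map_smul, map_smul]

/-- If the solutions `Z z` of the Volterra equations `Z = ∬ ((c₀ + z c₁) Z + c₁ (e^{-zT} gT - g₀))`
stay bounded for `0 ≤ re z`, then `g₀ = 0`. -/
theorem eq_zero_of_volterraSq_family_bounded {ℓ T : ℝ} (hℓ : 0 < ℓ) (hT : 0 < T)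
    {c₀ c₁ g₀ gT : C(Icc (0:ℝ) ℓ, ℂ)} (hc₁ : ∀ x, c₁ x ≠ 0) {M : ℝ}
    {Z : ℂ → C(Icc (0:ℝ) ℓ, ℂ)}
    (hZ : ∀ z : ℂ, Z z = volterraSq hℓ.le (c₀ + z • c₁) (Z z)
      + volterraSq hℓ.le c₁ (Complex.exp (-z * T) • gT - g₀))
    (hM : ∀ z : ℂ, 0 ≤ z.re → ‖Z z‖ ≤ M) : g₀ = 0 := by
  have hinj : Function.Injective (volterraSq hℓ.le c₁) := by
    rw [injective_iff_map_eq_zero]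
    intro f hf
    have h1 : c₁ * f = 0 := by
      apply volterra_injective hℓ
      apply volterra_injective hℓ
      rw [map_zero, map_zero]
      exact hf
    ext x
    exact (mul_eq_zero.1 (DFunLike.congr_fun h1 x)).resolve_left (hc₁ x)
  set R : ℂ → (C(Icc (0:ℝ) ℓ, ℂ) →L[ℂ] C(Icc (0:ℝ) ℓ, ℂ)) :=
    fun z => Ring.inverse (1 - volterraSq hℓ.le (c₀ + z • c₁)) with hR
  set H₀ := volterraSq hℓ.le c₁ g₀ with hH₀
  set HT := volterraSq hℓ.le c₁ gT with hHT
  have hleft : ∀ z f, R z (f - volterraSq hℓ.le (c₀ + z • c₁) f) = f := fun z f =>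
    DFunLike.congr_fun (Ring.inverse_mul_cancel _ (isUnit_one_sub_volterraSq hℓ.le _)) f
  have hright : ∀ z f, R z f - volterraSq hℓ.le (c₀ + z • c₁) (R z f) = f := fun z f =>
    DFunLike.congr_fun (Ring.mul_inverse_cancel _ (isUnit_one_sub_volterraSq hℓ.le _)) f
  have hdiff : Differentiable ℂ fun z => R z H₀ := by
    have h1 : Differentiable ℂ R := by
      simp only [hR, volterraSq_add_smul]
      refine differentiable_inverse_one_sub_affine
        (A := C(Icc (0:ℝ) ℓ, ℂ) →L[ℂ] C(Icc (0:ℝ) ℓ, ℂ)) fun z => ?_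
      rw [← volterraSq_add_smul]
      exact isUnit_one_sub_volterraSq hℓ.le _
    exact h1.clm_apply (differentiable_const _)
  set k₀ := ℓ ^ 2 * ‖c₀‖ with hk₀
  set k₁ := ℓ ^ 2 * ‖c₁‖ with hk₁
  have hRn : ∀ z, ‖R z‖ ≤ Real.exp √(k₀ + k₁ * ‖z‖) := by
    intro z
    refine (norm_inverse_one_sub_volterraSq_le hℓ.le _).trans (Real.exp_le_exp.2 ?_)
    apply Real.le_sqrt_of_sq_le
    rw [mul_pow, Real.sq_sqrt (norm_nonneg _), hk₀, hk₁]
    have : ‖c₀ + z • c₁‖ ≤ ‖c₀‖ + ‖z‖ * ‖c₁‖ :=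
      (norm_add_le _ _).trans (by rw [norm_smul])
    nlinarith [sq_nonneg ℓ]
  have hRf : ∀ z f, ‖R z f‖ ≤ ‖f‖ * Real.exp √(k₀ + k₁ * ‖z‖) := fun z f =>
    ((R z).le_opNorm f).trans (by rw [mul_comm]; gcongr; exact hRn z)
  have hk₀' : 0 ≤ k₀ := by positivity
  have hk₁' : 0 ≤ k₁ := by positivity
  have hsplit : ∀ z, R z H₀ = Complex.exp (-z * T) • R z HT - Z z := by
    intro z
    have h1 : Z z - volterraSq hℓ.le (c₀ + z • c₁) (Z z)
        = Complex.exp (-z * T) • HT - H₀ := by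
      rw [hH₀, hHT, ← map_smul, ← map_sub]
      exact sub_eq_iff_eq_add'.2 (hZ z)
    have h2 := hleft z (Z z)
    rw [h1, map_sub, map_smul] at h2
    rw [← h2]
    abel
  set δ := k₁ / T + 1 with hδ
  have hδ0 : 0 < δ := by positivity
  have hconst := apply_eq_apply_of_order_half_of_bounded_on_cone (f := fun z => R z H₀) hdiff
    hk₀' hk₁' (fun z => hRf z H₀) (C := ‖HT‖ * Real.exp (k₀ / (2 * δ) + δ / 2) + M) (by
      intro z hz
      have hre : 0 ≤ z.re := by linarith [norm_nonneg z]
      rw [hsplit z]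
      refine (norm_sub_le _ _).trans (add_le_add ?_ (hM z hre))
      rw [norm_smul, Complex.norm_exp]
      have h1 : (-z * (T : ℂ)).re = -(z.re * T) := by simp
      rw [h1]
      calc Real.exp (-(z.re * T)) * ‖R z HT‖
          ≤ Real.exp (-(z.re * T)) * (‖HT‖ * Real.exp √(k₀ + k₁ * ‖z‖)) := by
            gcongr; exact hRf z HT
        _ = ‖HT‖ * Real.exp (√(k₀ + k₁ * ‖z‖) - z.re * T) := by
            rw [Real.exp_sub, Real.exp_neg]; field_simp
        _ ≤ _ := by
            gcongr
            have hs0 : 0 ≤ k₀ + k₁ * ‖z‖ := by positivity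
            have h2 : √(k₀ + k₁ * ‖z‖) ≤ (k₀ + k₁ * ‖z‖) / (2 * δ) + δ / 2 := by
              have h3 := Real.sq_sqrt hs0
              have h4 := sq_nonneg (√(k₀ + k₁ * ‖z‖) - δ)
              have h5 : (k₀ + k₁ * ‖z‖) / (2 * δ) + δ / 2
                  = (√(k₀ + k₁ * ‖z‖) ^ 2 + δ ^ 2) / (2 * δ) := by
                rw [h3]; field_simp
              rw [h5, le_div_iff₀ (by positivity)]
              nlinarith
            have h6 : k₁ * ‖z‖ / (2 * δ) ≤ z.re * T := by
              rw [div_le_iff₀ (by positivity)]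
              have h7 : k₁ ≤ T * δ := by rw [hδ]; field_simp; linarith
              nlinarith [norm_nonneg z, mul_le_mul_of_nonneg_right h7 (norm_nonneg z),
                mul_le_mul_of_nonneg_left hz (mul_pos hT hδ0).le]
            rw [add_div] at h2
            linarith)
  have hY : R 0 H₀ = 0 := by
    apply hinj
    have h0 := hright 0 H₀
    have h1 := hright 1 H₀
    rw [← hconst 0 1, ← sub_eq_zero, volterraSq_add_smul] at h1
    rw [volterraSq_add_smul] at h0
    have h2 := (congrArg₂ (· - ·) h0 (sub_eq_zero.1 h1)).symm
    have h3 : (0 : ℂ) • volterraSq hℓ.le c₁ (R 0 H₀) = 0 := by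
      ext x; exact zero_mul _
    have h4 : (0 : C(Icc (0:ℝ) ℓ, ℂ)) = volterraSq hℓ.le c₁ (R 0 H₀)
        - (0 : ℂ) • volterraSq hℓ.le c₁ (R 0 H₀) := by simpa using h2
    rw [h3, sub_zero] at h4
    rw [map_zero, ← h4]
  have hH : H₀ = 0 := by
    have := hright 0 H₀
    rw [hY, map_zero, sub_zero] at this
    exact this.symm
  exact hinj (by rw [map_zero]; exact hH)

/-- Tietze extension of a function of two variables from a closed set. -/
theorem exists_continuous_eqOn_of_isClosed {S : Set (ℝ × ℝ)} (hS : IsClosed S) {f : ℝ → ℝ → ℂ}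
    (hf : ContinuousOn (fun z : ℝ × ℝ => f z.1 z.2) S) :
    ∃ g : ℝ → ℝ → ℂ, Continuous (Function.uncurry g) ∧ ∀ x y, (x, y) ∈ S → f x y = g x y := by
  obtain ⟨g, hg⟩ := ContinuousMap.exists_restrict_eq hS ⟨_, hf.domRestrict⟩
  refine ⟨fun x y => g (x, y), g.continuous, fun x y hxy => ?_⟩
  exact (DFunLike.congr_fun hg ⟨(x, y), hxy⟩).symm

/-- `U`, with derivative `U₁`, solves `a U'' = (p + κ) U + F` on `(0,ℓ)` and is `C¹` up to the
boundary. -/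
def IsODESol (ℓ : ℝ) (a p : ℝ → ℝ) (κ : ℂ) (F U U₁ : ℝ → ℂ) : Prop :=
  ContinuousOn U (Icc 0 ℓ) ∧ ContinuousOn U₁ (Icc 0 ℓ) ∧
  ∀ x ∈ Ioo 0 ℓ, HasDerivAt U (U₁ x) x ∧ HasDerivAt U₁ (((p x + κ) * U x + F x) / a x) x

theorem IsODESol.sub {ℓ : ℝ} {a p : ℝ → ℝ} {κ : ℂ} {F G U U₁ V V₁ : ℝ → ℂ}
    (hU : IsODESol ℓ a p κ F U U₁) (hV : IsODESol ℓ a p κ G V V₁) :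
    IsODESol ℓ a p κ (fun x => F x - G x) (fun x => U x - V x) (fun x => U₁ x - V₁ x) := by
  refine ⟨hU.1.sub hV.1, hU.2.1.sub hV.2.1, fun x hx => ⟨(hU.2.2 x hx).1.sub (hV.2.2 x hx).1, ?_⟩⟩
  exact ((hU.2.2 x hx).2.sub (hV.2.2 x hx).2).congr_deriv (by ring)

section TimeIntegral

variable {T ℓ : ℝ}

theorem continuousOn_integral_of_continuousOn_prod (hT : 0 ≤ T) {f : ℝ → ℝ → ℂ}
    (hf : ContinuousOn (fun z : ℝ × ℝ => f z.1 z.2) (Icc 0 T ×ˢ Icc 0 ℓ)) :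
    ContinuousOn (fun x => ∫ t in (0:ℝ)..T, f t x) (Icc 0 ℓ) := by
  obtain ⟨g, hg, hfg⟩ := exists_continuous_eqOn_of_isClosed (isClosed_Icc.prod isClosed_Icc) hf
  have h : Continuous fun x => ∫ t in (0:ℝ)..T, g t x :=
    continuous_parametric_intervalIntegral_of_continuous'
      (f := fun x t => g t x) (hg.comp continuous_swap) 0 T
  refine h.continuousOn.congr fun x hx => integral_congr fun t ht => ?_
  rw [uIcc_of_le hT] at ht
  exact hfg t x ⟨ht, hx⟩

theorem continuousOn_slice {f : ℝ → ℝ → ℂ}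
    (hf : ContinuousOn (fun z : ℝ × ℝ => f z.1 z.2) (Icc 0 T ×ˢ Icc 0 ℓ)) {x : ℝ}
    (hx : x ∈ Icc 0 ℓ) : ContinuousOn (fun t => f t x) (Icc 0 T) :=
  hf.comp (by fun_prop : Continuous fun t : ℝ => (t, x)).continuousOn fun _ ht => ⟨ht, hx⟩

theorem hasDerivAt_integral_of_continuousOn_prod (hT : 0 ≤ T) {f f' : ℝ → ℝ → ℂ}
    (hf : ContinuousOn (fun z : ℝ × ℝ => f z.1 z.2) (Icc 0 T ×ˢ Icc 0 ℓ))
    (hf' : ContinuousOn (fun z : ℝ × ℝ => f' z.1 z.2) (Icc 0 T ×ˢ Icc 0 ℓ))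
    (hd : ∀ t ∈ Icc 0 T, ∀ x ∈ Ioo 0 ℓ, HasDerivAt (f t) (f' t x) x) {x : ℝ} (hx : x ∈ Ioo 0 ℓ) :
    HasDerivAt (fun x => ∫ t in (0:ℝ)..T, f t x) (∫ t in (0:ℝ)..T, f' t x) x := by
  obtain ⟨M, hM⟩ := (isCompact_Icc.prod isCompact_Icc).exists_bound_of_continuousOn hf'
  have hmem : ∀ t, t ∈ uIoc 0 T → t ∈ Icc 0 T := fun t ht => by
    rw [uIoc_of_le hT] at ht
    exact Ioc_subset_Icc_self ht
  have hint : ∀ g : ℝ → ℝ → ℂ, ContinuousOn (fun z : ℝ × ℝ => g z.1 z.2) (Icc 0 T ×ˢ Icc 0 ℓ) →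
      ∀ y ∈ Ioo 0 ℓ, IntervalIntegrable (fun t => g t y) volume 0 T := fun g hg y hy =>
    (continuousOn_slice hg (Ioo_subset_Icc_self hy)).intervalIntegrable_of_Icc hT
  refine (intervalIntegral.hasDerivAt_integral_of_dominated_loc_of_deriv_le (F := fun x t => f t x)
    (F' := fun x t => f' t x) (bound := fun _ => M) (Ioo_mem_nhds hx.1 hx.2) ?_ (hint f hf x hx)
    (hint f' hf' x hx).aestronglyMeasurable_restrict_uIoc ?_ (by simp) ?_).2
  · filter_upwards [Ioo_mem_nhds hx.1 hx.2] with y hy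
    exact (hint f hf y hy).aestronglyMeasurable_restrict_uIoc
  · exact Filter.Eventually.of_forall fun t ht y hy =>
      hM (t, y) ⟨hmem t ht, Ioo_subset_Icc_self hy⟩
  · exact Filter.Eventually.of_forall fun t ht y hy => hd t (hmem t ht) y hy

/-- The truncated Laplace transform in time of a solution of `σ ∂ₜu = a ∂ₓ²u - p u` solves an
ordinary differential equation in space. -/
theorem IsC12.isODESol_laplace (hT : 0 < T) {σ : ℂ} {a p : ℝ → ℝ}
    (ha : ∀ x ∈ Icc (0:ℝ) ℓ, 0 < a x) {u ut ux uxx : ℝ → ℝ → ℂ} (hu : IsC12 T ℓ u ut ux uxx)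
    (hpde : ∀ t ∈ Ioo (0:ℝ) T, ∀ x ∈ Ioo (0:ℝ) ℓ, σ * ut t x = a x * uxx t x - p x * u t x)
    (z : ℂ) :
    IsODESol ℓ a p (σ * z) (fun x => σ * (Complex.exp (-z * T) * u T x - u 0 x))
      (fun x => ∫ t in (0:ℝ)..T, Complex.exp (-z * t) * u t x)
      (fun x => ∫ t in (0:ℝ)..T, Complex.exp (-z * t) * ux t x) := by
  obtain ⟨hd, hc, hct, hcx, hcxx⟩ := hu
  have hexp : ∀ g : ℝ → ℝ → ℂ, ContinuousOn (fun z : ℝ × ℝ => g z.1 z.2) (Icc 0 T ×ˢ Icc 0 ℓ) →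
      ContinuousOn (fun w : ℝ × ℝ => Complex.exp (-z * w.1) * g w.1 w.2) (Icc 0 T ×ˢ Icc 0 ℓ) :=
    fun g hg => (by fun_prop :
      Continuous fun w : ℝ × ℝ => Complex.exp (-z * w.1)).continuousOn.mul hg
  refine ⟨continuousOn_integral_of_continuousOn_prod hT.le (hexp u hc),
    continuousOn_integral_of_continuousOn_prod hT.le (hexp ux hcx), fun x hx => ⟨?_, ?_⟩⟩
  · exact hasDerivAt_integral_of_continuousOn_prod hT.le
      (f := fun t x => Complex.exp (-z * t) * u t x)
      (f' := fun t x => Complex.exp (-z * t) * ux t x) (hexp u hc) (hexp ux hcx)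
      (fun t ht x hx => ((hd t ht x (Ioo_subset_Icc_self hx)).2.1.hasDerivAt
        (Icc_mem_nhds hx.1 hx.2)).const_mul _) hx
  · have h := hasDerivAt_integral_of_continuousOn_prod hT.le
      (f := fun t x => Complex.exp (-z * t) * ux t x)
      (f' := fun t x => Complex.exp (-z * t) * uxx t x) (hexp ux hcx) (hexp uxx hcxx)
      (fun t ht x hx => ((hd t ht x (Ioo_subset_Icc_self hx)).2.2.hasDerivAt
        (Icc_mem_nhds hx.1 hx.2)).const_mul _) hx
    refine h.congr_deriv ?_
    have hx' := Ioo_subset_Icc_self hx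
    have hax : (a x : ℂ) ≠ 0 := Complex.ofReal_ne_zero.2 (ha x hx').ne'
    have hEu : ContinuousOn (fun t : ℝ => Complex.exp (-z * t) * u t x) (Icc 0 T) :=
      continuousOn_slice (f := fun t x => Complex.exp (-z * t) * u t x) (hexp u hc) hx'
    have hEt : ContinuousOn (fun t : ℝ => Complex.exp (-z * t) * ut t x) (Icc 0 T) :=
      continuousOn_slice (f := fun t x => Complex.exp (-z * t) * ut t x) (hexp ut hct) hx'
    have hiu : IntervalIntegrable (fun t : ℝ => Complex.exp (-z * t) * u t x) volume 0 T :=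
      hEu.intervalIntegrable_of_Icc hT.le
    have hit : IntervalIntegrable (fun t : ℝ => Complex.exp (-z * t) * ut t x) volume 0 T :=
      hEt.intervalIntegrable_of_Icc hT.le
    have hftc := integral_eq_sub_of_hasDerivAt_of_le hT.le hEu
      (f' := fun t : ℝ => Complex.exp (-z * t) * ut t x - z * (Complex.exp (-z * t) * u t x))
      (fun t ht => by
        have h1 : HasDerivAt (fun t : ℝ => Complex.exp (-z * t)) (Complex.exp (-z * t) * -z) t := by
          simpa using (Complex.ofRealCLM.hasDerivAt.const_mul (-z)).cexp
        have h2 := (hd t (Ioo_subset_Icc_self ht) x hx').1.hasDerivAt (Icc_mem_nhds ht.1 ht.2)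
        exact (h1.mul h2).congr_deriv (by ring)) (hit.sub (hiu.const_mul z))
    rw [intervalIntegral.integral_sub hit (hiu.const_mul z), intervalIntegral.integral_const_mul]
      at hftc
    have hcongr : ∫ t in (0:ℝ)..T, Complex.exp (-z * t) * uxx t x
        = ∫ t in (0:ℝ)..T, (a x : ℂ)⁻¹ * (σ * (Complex.exp (-z * t) * ut t x)
          + p x * (Complex.exp (-z * t) * u t x)) := by
      rw [integral_of_le hT.le, integral_of_le hT.le, integral_Ioc_eq_integral_Ioo,
        integral_Ioc_eq_integral_Ioo]
      refine setIntegral_congr_fun measurableSet_Ioo fun t ht => ?_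
      have := hpde t ht x hx
      field_simp
      linear_combination -this
    rw [hcongr, intervalIntegral.integral_const_mul, intervalIntegral.integral_add
      (hit.const_mul σ) (hiu.const_mul _), intervalIntegral.integral_const_mul,
      intervalIntegral.integral_const_mul, sub_eq_iff_eq_add.1 hftc]
    simp
    field_simp
    ring

end TimeIntegral

/-- Fubini's theorem on a triangle. -/
theorem integral_integral_triangle {g : ℝ → ℝ → ℂ} (hg : Continuous (Function.uncurry g)) {x : ℝ}
    (hx : 0 ≤ x) :
    ∫ y in (0:ℝ)..x, ∫ s in y..x, g s y = ∫ s in (0:ℝ)..x, ∫ y in (0:ℝ)..s, g s y := by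
  set S : Set (ℝ × ℝ) := {z | z.2 ≤ z.1} with hS
  have hSm : MeasurableSet S := (isClosed_le continuous_snd continuous_fst).measurableSet
  have hint : Integrable (Function.uncurry fun s y => S.indicator (Function.uncurry g) (s, y))
      ((volume.restrict (Ioc 0 x)).prod (volume.restrict (Ioc 0 x))) := by
    rw [Measure.prod_restrict]
    exact ((hg.continuousOn.integrableOn_compact (isCompact_Icc.prod isCompact_Icc)).mono_set
      (prod_mono Ioc_subset_Icc_self Ioc_subset_Icc_self)).indicator hSm
  have hswap := integral_integral_swap hint
  rw [integral_of_le hx, integral_of_le hx]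
  refine Eq.trans ?_ (hswap.symm.trans ?_)
  · refine setIntegral_congr_fun measurableSet_Ioc fun y hy => ?_
    have h1 : (fun s => S.indicator (Function.uncurry g) (s, y))
        = (Ici y).indicator fun s => g s y := by
      ext s
      by_cases h : y ≤ s <;> simp [S, indicator, h]
    have h2 : Ioc 0 x ∩ Ici y = Icc y x := by
      ext s
      simp only [mem_inter_iff, mem_Ioc, mem_Ici, mem_Icc]
      exact ⟨fun h => ⟨h.2, h.1.2⟩, fun h => ⟨⟨hy.1.trans_le h.1, h.2⟩, h.1⟩⟩
    simp only [h1]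
    rw [setIntegral_indicator measurableSet_Ici, h2, integral_Icc_eq_integral_Ioc,
      integral_of_le hy.2]
  · refine setIntegral_congr_fun measurableSet_Ioc fun s hs => ?_
    have h1 : (fun y => S.indicator (Function.uncurry g) (s, y))
        = (Iic s).indicator fun y => g s y := by
      ext y
      by_cases h : y ≤ s <;> simp [S, indicator, h]
    have h2 : Ioc 0 x ∩ Iic s = Ioc 0 s := by
      ext y
      simp only [mem_inter_iff, mem_Ioc, mem_Iic]
      exact ⟨fun h => ⟨h.1.1, h.2⟩, fun h => ⟨⟨h.1, h.2.trans hs.2⟩, h.2⟩⟩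
    simp only [h1]
    rw [setIntegral_indicator measurableSet_Iic, h2, integral_of_le hs.1.le]

/-- The closed triangle `0 ≤ y ≤ x ≤ ℓ`. -/
def triangle (ℓ : ℝ) : Set (ℝ × ℝ) := {z | 0 ≤ z.2 ∧ z.2 ≤ z.1 ∧ z.1 ≤ ℓ}

section Triangle

variable {ℓ : ℝ}

theorem isClosed_triangle : IsClosed (triangle ℓ) :=
  (isClosed_le continuous_const continuous_snd).inter
    ((isClosed_le continuous_snd continuous_fst).inter
      (isClosed_le continuous_fst continuous_const))

theorem isCompact_triangle : IsCompact (triangle ℓ) :=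
  (isCompact_Icc (a := ((0:ℝ), (0:ℝ))) (b := (ℓ, ℓ))).of_isClosed_subset isClosed_triangle
    fun _ hz => ⟨⟨hz.1.trans hz.2.1, hz.1⟩, ⟨hz.2.2, hz.2.1.trans hz.2.2⟩⟩

theorem triangle_mem_nhds {x y : ℝ} (hy : 0 < y) (hyx : y < x) (hx : x < ℓ) :
    triangle ℓ ∈ nhds (x, y) := by
  have h : IsOpen {z : ℝ × ℝ | 0 < z.2 ∧ z.2 < z.1 ∧ z.1 < ℓ} :=
    (isOpen_lt continuous_const continuous_snd).inter
      ((isOpen_lt continuous_snd continuous_fst).inter (isOpen_lt continuous_fst continuous_const))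
  exact Filter.mem_of_superset (h.mem_nhds ⟨hy, hyx, hx⟩)
    fun z hz => ⟨hz.1.le, hz.2.1.le, hz.2.2.le⟩

theorem uniqueDiffOn_triangle (hℓ : 0 < ℓ) : UniqueDiffOn ℝ (triangle ℓ) := by
  refine uniqueDiffOn_convex ?_ ⟨(2 * ℓ / 3, ℓ / 3), mem_interior_iff_mem_nhds.2
    (triangle_mem_nhds (by linarith) (by linarith) (by linarith))⟩
  intro z hz w hw s t hs ht hst
  obtain ⟨h1, h2, h3⟩ := hz
  obtain ⟨h4, h5, h6⟩ := hw
  refine ⟨?_, ?_, ?_⟩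
  · simp only [Prod.snd_add, Prod.smul_snd, smul_eq_mul]
    positivity
  · simp only [Prod.snd_add, Prod.smul_snd, smul_eq_mul, Prod.fst_add, Prod.smul_fst]
    gcongr
  · simp only [smul_eq_mul, Prod.fst_add, Prod.smul_fst]
    calc s * z.1 + t * w.1 ≤ s * ℓ + t * ℓ := by gcongr
      _ = ℓ := by rw [← add_mul, hst, one_mul]

theorem continuousOn_triangle_slice {E : Type*} [TopologicalSpace E] {f : ℝ → ℝ → E}
    (hf : ContinuousOn (fun z : ℝ × ℝ => f z.1 z.2) (triangle ℓ)) {x : ℝ} (hx : x ≤ ℓ) :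
    ContinuousOn (f x) (Icc 0 x) :=
  hf.comp (by fun_prop : Continuous fun y : ℝ => (x, y)).continuousOn
    fun _ hy => ⟨hy.1, hy.2, hx⟩

theorem continuousOn_triangle_diag {E : Type*} [TopologicalSpace E] {f : ℝ → ℝ → E}
    (hf : ContinuousOn (fun z : ℝ × ℝ => f z.1 z.2) (triangle ℓ)) :
    ContinuousOn (fun x => f x x) (Icc 0 ℓ) :=
  hf.comp (by fun_prop : Continuous fun y : ℝ => (y, y)).continuousOn
    fun _ hy => ⟨hy.1, le_rfl, hy.2⟩

theorem continuousOn_integral_triangle {f : ℝ → ℝ → ℂ}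
    (hf : ContinuousOn (fun z : ℝ × ℝ => f z.1 z.2) (triangle ℓ)) :
    ContinuousOn (fun x => ∫ y in (0:ℝ)..x, f x y) (Icc 0 ℓ) := by
  obtain ⟨g, hg, hfg⟩ := exists_continuous_eqOn_of_isClosed isClosed_triangle hf
  have h : Continuous fun x => ∫ y in (0:ℝ)..x, g x y :=
    continuous_parametric_intervalIntegral_of_continuous hg continuous_id
  refine h.continuousOn.congr fun x hx => integral_congr fun y hy => ?_
  rw [uIcc_of_le hx.1] at hy
  exact hfg x y ⟨hy.1, hy.2, hx.2⟩

/-- Leibniz rule for `x ↦ ∫₀ˣ f(x,y) dy`. -/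
theorem hasDerivAt_integral_triangle {f f' : ℝ → ℝ → ℂ}
    (hf : ContinuousOn (fun z : ℝ × ℝ => f z.1 z.2) (triangle ℓ))
    (hf' : ContinuousOn (fun z : ℝ × ℝ => f' z.1 z.2) (triangle ℓ))
    (hd : ∀ x y, 0 < y → y < x → x < ℓ → HasDerivAt (fun s => f s y) (f' x y) x) {x : ℝ}
    (hx : x ∈ Ioo 0 ℓ) :
    HasDerivAt (fun x => ∫ y in (0:ℝ)..x, f x y) (f x x + ∫ y in (0:ℝ)..x, f' x y) x := by
  obtain ⟨F, hF, hfF⟩ := exists_continuous_eqOn_of_isClosed isClosed_triangle hf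
  obtain ⟨G, hG, hfG⟩ := exists_continuous_eqOn_of_isClosed isClosed_triangle hf'
  have hFd : Continuous fun y => F y y := hF.comp (by fun_prop : Continuous fun y : ℝ => (y, y))
  have hGi : Continuous fun s => ∫ y in (0:ℝ)..s, G s y :=
    continuous_parametric_intervalIntegral_of_continuous hG continuous_id
  have hrep : ∀ r ∈ Ioo 0 ℓ, ∫ y in (0:ℝ)..r, f r y
      = (∫ y in (0:ℝ)..r, F y y) + ∫ s in (0:ℝ)..r, ∫ y in (0:ℝ)..s, G s y := by
    intro r hr
    have hGi' : Continuous fun y => ∫ s in y..r, G s y := by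
      simp_rw [integral_symm r]
      exact (continuous_parametric_intervalIntegral_of_continuous (f := fun y s => G s y)
        (hG.comp continuous_swap) continuous_id).neg
    rw [← integral_integral_triangle hG hr.1.le,
      ← intervalIntegral.integral_add (hFd.intervalIntegrable _ _) (hGi'.intervalIntegrable _ _),
      integral_of_le hr.1.le, integral_of_le hr.1.le]
    refine setIntegral_congr_fun measurableSet_Ioc fun y hy => ?_
    have hftc := integral_eq_sub_of_hasDerivAt_of_le hy.2 (f := fun s => f s y)
      (f' := fun s => G s y)
      (hf.comp (by fun_prop : Continuous fun s : ℝ => (s, y)).continuousOn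
        fun s hs => ⟨hy.1.le, hs.1, hs.2.trans hr.2.le⟩)
      (fun s hs => by
        rw [← hfG s y ⟨hy.1.le, hs.1.le, hs.2.le.trans hr.2.le⟩]
        exact hd s y hy.1 hs.1 (hs.2.trans hr.2))
      ((hG.comp (by fun_prop : Continuous fun s : ℝ => (s, y))).intervalIntegrable _ _)
    rw [hftc, ← hfF y y ⟨hy.1.le, le_rfl, hy.2.trans hr.2.le⟩]
    ring
  have hder := (hFd.integral_hasStrictDerivAt 0 x).hasDerivAt.add
    (hGi.integral_hasStrictDerivAt 0 x).hasDerivAt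
  have hval : f x x + ∫ y in (0:ℝ)..x, f' x y = F x x + ∫ y in (0:ℝ)..x, G x y := by
    rw [hfF x x ⟨hx.1.le, le_rfl, hx.2.le⟩]
    congr 1
    refine integral_congr fun y hy => ?_
    rw [uIcc_of_le hx.1.le] at hy
    exact hfG x y ⟨hy.1, hy.2, hx.2.le⟩
  rw [hval]
  refine hder.congr_of_eventuallyEq ?_
  filter_upwards [Ioo_mem_nhds hx.1 hx.2] with r hr
  exact hrep r hr

end Triangle

section Kernel

variable {ℓ : ℝ} {a p q : ℝ → ℝ} {K : ℝ → ℝ → ℝ}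

/-- The properties of a solution `K` of the Goursat problem which make `I + ∫₀ˣ K` a transmutation
operator; `Kx`, `Kxx`, `L` play the roles of `∂ₓK`, `∂ₓ²K` and `∂_y(a(y)K)`. -/
structure IsTransmutationKernel (ℓ : ℝ) (a p q : ℝ → ℝ) (K Kx Kxx L : ℝ → ℝ → ℝ) : Prop where
  continuousOn : ContinuousOn (fun z : ℝ × ℝ => K z.1 z.2) (triangle ℓ)
  continuousOn_x : ContinuousOn (fun z : ℝ × ℝ => Kx z.1 z.2) (triangle ℓ)
  continuousOn_xx : ContinuousOn (fun z : ℝ × ℝ => Kxx z.1 z.2) (triangle ℓ)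
  continuousOn_L : ContinuousOn (fun z : ℝ × ℝ => L z.1 z.2) (triangle ℓ)
  hasDerivAt_x : ∀ x y, 0 < y → y < x → x < ℓ → HasDerivAt (fun s => K s y) (Kx x y) x
  hasDerivAt_xx : ∀ x y, 0 < y → y < x → x < ℓ → HasDerivAt (fun s => Kx s y) (Kxx x y) x
  hasDerivAt_mul : ∀ x y, 0 < y → y < x → x < ℓ →
    HasDerivAt (fun s => a s * K x s) (L x y) y
  hasDerivAt_L : ∀ x y, 0 < y → y < x → x < ℓ →
    HasDerivAt (L x) (a x * Kxx x y - (q x - p y) * K x y) y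
  diag : ∀ x ∈ Ioo 0 ℓ, ∃ d, HasDerivAt (fun s => K s s) d x ∧
    a x * d + a x * Kx x x + L x x = q x - p x
  bottom : ∀ x ∈ Ioo 0 ℓ, L x 0 = 0

theorem hasFDerivAt_of_contDiffOn_triangle {f : ℝ × ℝ → ℝ} (hf : ContDiffOn ℝ 1 f (triangle ℓ))
    {x y : ℝ} (hy : 0 < y) (hyx : y < x) (hx : x < ℓ) :
    HasFDerivAt f (fderivWithin ℝ f (triangle ℓ) (x, y)) (x, y) :=
  (hf.differentiableOn one_ne_zero (x, y) ⟨hy.le, hyx.le, hx.le⟩).hasFDerivWithinAt.hasFDerivAt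
    (triangle_mem_nhds hy hyx hx)

theorem hasDerivAt_fst_of_contDiffOn_triangle {f : ℝ × ℝ → ℝ}
    (hf : ContDiffOn ℝ 1 f (triangle ℓ)) {x y : ℝ} (hy : 0 < y) (hyx : y < x) (hx : x < ℓ) :
    HasDerivAt (fun s => f (s, y)) (fderivWithin ℝ f (triangle ℓ) (x, y) (1, 0)) x :=
  (hasFDerivAt_of_contDiffOn_triangle hf hy hyx hx).comp_hasDerivAt (f := fun s => (s, y)) x
    ((hasDerivAt_id x).prodMk (hasDerivAt_const x y))

theorem hasDerivAt_snd_of_contDiffOn_triangle {f : ℝ × ℝ → ℝ}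
    (hf : ContDiffOn ℝ 1 f (triangle ℓ)) {x y : ℝ} (hy : 0 < y) (hyx : y < x) (hx : x < ℓ) :
    HasDerivAt (fun s => f (x, s)) (fderivWithin ℝ f (triangle ℓ) (x, y) (0, 1)) y :=
  (hasFDerivAt_of_contDiffOn_triangle hf hy hyx hx).comp_hasDerivAt (f := fun s => (x, s)) y
    ((hasDerivAt_const y x).prodMk (hasDerivAt_id y))

theorem hasDerivWithinAt_comp_of_contDiffOn_triangle {f : ℝ × ℝ → ℝ}
    (hf : ContDiffOn ℝ 1 f (triangle ℓ)) {g h : ℝ → ℝ} {g' h' x : ℝ} {S : Set ℝ} (hx : x ∈ S)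
    (hg : HasDerivWithinAt g g' S x) (hh : HasDerivWithinAt h h' S x)
    (hS : MapsTo (fun s => (g s, h s)) S (triangle ℓ)) :
    HasDerivWithinAt (fun s => f (g s, h s))
      (fderivWithin ℝ f (triangle ℓ) (g x, h x) (g', h')) S x :=
  (hf.differentiableOn one_ne_zero (g x, h x) (hS hx)).hasFDerivWithinAt.comp_hasDerivWithinAt
    (f := fun s => (g s, h s)) x (hg.prodMk hh) hS

theorem IsGoursatSol.exists_isTransmutationKernel (hℓ : 0 < ℓ) (ha : ContDiffOn ℝ 2 a (Icc 0 ℓ))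
    (hK : IsGoursatSol ℓ a p q K) : ∃ Kx Kxx L, IsTransmutationKernel ℓ a p q K Kx Kxx L := by
  obtain ⟨hC, hpde, hbot, hdiag, -⟩ := hK
  change ContDiffOn ℝ 2 _ (triangle ℓ) at hC
  set k : ℝ × ℝ → ℝ := fun z => K z.1 z.2 with hk
  have hu := uniqueDiffOn_triangle hℓ
  have hC1 : ContDiffOn ℝ 1 k (triangle ℓ) := hC.of_le one_le_two
  have hD : ContDiffOn ℝ 1 (fderivWithin ℝ k (triangle ℓ)) (triangle ℓ) :=
    hC.fderivWithin hu (by norm_num)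
  set kx : ℝ × ℝ → ℝ := fun z => fderivWithin ℝ k (triangle ℓ) z (1, 0) with hkx
  set ky : ℝ × ℝ → ℝ := fun z => fderivWithin ℝ k (triangle ℓ) z (0, 1) with hky
  have hkx1 : ContDiffOn ℝ 1 kx (triangle ℓ) := hD.clm_apply contDiffOn_const
  have hky1 : ContDiffOn ℝ 1 ky (triangle ℓ) := hD.clm_apply contDiffOn_const
  have hkxx : ContinuousOn (fun z => fderivWithin ℝ kx (triangle ℓ) z (1, 0)) (triangle ℓ) :=
    (hkx1.continuousOn_fderivWithin hu le_rfl).clm_apply continuousOn_const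
  have huI := uniqueDiffOn_Icc hℓ
  set a1 := derivWithin a (Icc 0 ℓ) with ha1
  have ha1C : ContDiffOn ℝ 1 a1 (Icc 0 ℓ) := ha.derivWithin huI (by norm_num)
  have had : ∀ y ∈ Ioo 0 ℓ, HasDerivAt a (a1 y) y := fun y hy =>
    (ha.differentiableOn two_ne_zero y (Ioo_subset_Icc_self hy)).hasDerivWithinAt.hasDerivAt
      (Icc_mem_nhds hy.1 hy.2)
  have hsnd : MapsTo Prod.snd (triangle ℓ) (Icc 0 ℓ) := fun z hz => ⟨hz.1, hz.2.1.trans hz.2.2⟩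
  have hmul : ∀ x y, 0 < y → y < x → x < ℓ →
      HasDerivAt (fun s => a s * K x s) (a1 y * K x y + a y * ky (x, y)) y :=
    fun x y hy hyx hx => (had y ⟨hy, hyx.trans hx⟩).mul
      (hasDerivAt_snd_of_contDiffOn_triangle hC1 hy hyx hx)
  refine ⟨fun x y => kx (x, y), fun x y => fderivWithin ℝ kx (triangle ℓ) (x, y) (1, 0),
    fun x y => a1 y * K x y + a y * ky (x, y), hC.continuousOn, hkx1.continuousOn, hkxx, ?_,
    fun x y hy hyx hx => hasDerivAt_fst_of_contDiffOn_triangle hC1 hy hyx hx,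
    fun x y hy hyx hx => hasDerivAt_fst_of_contDiffOn_triangle hkx1 hy hyx hx, hmul, ?_, ?_, ?_⟩
  · exact ((ha1C.continuousOn.comp continuousOn_snd hsnd).mul hC.continuousOn).add
      ((ha.continuousOn.comp continuousOn_snd hsnd).mul hky1.continuousOn)
  · intro x y hy hyx hx
    have hyI : y ∈ Ioo 0 ℓ := ⟨hy, hyx.trans hx⟩
    have hL : DifferentiableAt ℝ (fun s => a1 s * K x s + a s * ky (x, s)) y :=
      ((((ha1C.differentiableOn one_ne_zero y (Ioo_subset_Icc_self hyI)).differentiableAt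
        (Icc_mem_nhds hyI.1 hyI.2))).mul
        (hasDerivAt_snd_of_contDiffOn_triangle hC1 hy hyx hx).differentiableAt).add
      ((had y hyI).differentiableAt.mul
        (hasDerivAt_snd_of_contDiffOn_triangle hky1 hy hyx hx).differentiableAt)
    have h1 : deriv (fun s => deriv (fun s' => K s' y) s) x
        = fderivWithin ℝ kx (triangle ℓ) (x, y) (1, 0) := by
      rw [← (hasDerivAt_fst_of_contDiffOn_triangle hkx1 hy hyx hx).deriv]
      refine Filter.EventuallyEq.deriv_eq ?_
      filter_upwards [Ioo_mem_nhds hyx hx] with s hs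
      exact (hasDerivAt_fst_of_contDiffOn_triangle hC1 hy hs.1 hs.2).deriv
    have h2 : deriv (fun s => deriv (fun s' => a s' * K x s') s) y
        = deriv (fun s => a1 s * K x s + a s * ky (x, s)) y := by
      refine Filter.EventuallyEq.deriv_eq ?_
      filter_upwards [Ioo_mem_nhds hy hyx] with s hs
      exact (hmul x s hs.1 hs.2 hx).deriv
    refine hL.hasDerivAt.congr_deriv ?_
    rw [← h2, ← h1, ← hpde x y hy hyx hx]
    ring
  · intro x hx
    have hxI := Ioo_subset_Icc_self hx
    have hd : HasDerivWithinAt (fun s => K s s) (kx (x, x) + ky (x, x)) (Icc 0 ℓ) x := by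
      have h := hasDerivWithinAt_comp_of_contDiffOn_triangle hC1 hxI (hasDerivWithinAt_id x _)
        (hasDerivWithinAt_id x _) fun s hs => ⟨hs.1, le_rfl, hs.2⟩
      refine h.congr_deriv ?_
      rw [hkx, hky, ← map_add]
      simp
    refine ⟨_, hd.hasDerivAt (Icc_mem_nhds hx.1 hx.2), ?_⟩
    have := hdiag x hx.1 hx.2
    rw [hd.derivWithin (huI x hxI)] at this
    linear_combination this
  · intro x hx
    have hd : HasDerivWithinAt (fun s => K x s) (ky (x, 0)) (Icc 0 x) 0 :=
      hasDerivWithinAt_comp_of_contDiffOn_triangle hC1 (left_mem_Icc.2 hx.1.le)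
        (hasDerivWithinAt_const 0 _ x) (hasDerivWithinAt_id 0 _) fun s hs => ⟨hs.1, hs.2, hx.2.le⟩
    have := hbot x hx.1 hx.2
    rw [hd.derivWithin (uniqueDiffOn_Icc hx.1 0 ⟨le_rfl, hx.1.le⟩)] at this
    linear_combination this

variable {Kx Kxx L : ℝ → ℝ → ℝ}

theorem continuousOn_ofReal_mul_triangle {k : ℝ → ℝ → ℝ} {U : ℝ → ℂ}
    (hk : ContinuousOn (fun z : ℝ × ℝ => k z.1 z.2) (triangle ℓ)) (hU : ContinuousOn U (Icc 0 ℓ)) :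
    ContinuousOn (fun z : ℝ × ℝ => (k z.1 z.2 : ℂ) * U z.2) (triangle ℓ) :=
  (Complex.continuous_ofReal.comp_continuousOn hk).mul
    (hU.comp continuousOn_snd fun _ hz => ⟨hz.1, hz.2.1.trans hz.2.2⟩)

/-- `I + ∫₀ˣ K` maps solutions of the equation with potential `p` to solutions of the equation with
potential `q`. -/
theorem IsODESol.transmute (ha : ContinuousOn a (Icc 0 ℓ)) (hapos : ∀ x ∈ Icc 0 ℓ, 0 < a x)
    (hK : IsTransmutationKernel ℓ a p q K Kx Kxx L) {κ : ℂ} {F U U₁ : ℝ → ℂ}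
    (hF : ContinuousOn F (Icc 0 ℓ)) (hU : IsODESol ℓ a p κ F U U₁) (hU₁ : U₁ 0 = 0) :
    IsODESol ℓ a q κ (fun x => F x + ∫ y in (0:ℝ)..x, K x y * F y)
      (fun x => U x + ∫ y in (0:ℝ)..x, K x y * U y)
      (fun x => U₁ x + (K x x * U x + ∫ y in (0:ℝ)..x, Kx x y * U y)) := by
  obtain ⟨hUc, hU₁c, hUd⟩ := hU
  have hKU := continuousOn_ofReal_mul_triangle hK.continuousOn hUc
  have hKF := continuousOn_ofReal_mul_triangle hK.continuousOn hF
  have hKxU := continuousOn_ofReal_mul_triangle hK.continuousOn_x hUc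
  have hKxxU := continuousOn_ofReal_mul_triangle hK.continuousOn_xx hUc
  refine ⟨hUc.add (continuousOn_integral_triangle (f := fun x y => (K x y : ℂ) * U y) hKU),
    hU₁c.add (((Complex.continuous_ofReal.comp_continuousOn
      (continuousOn_triangle_diag hK.continuousOn)).mul hUc).add
      (continuousOn_integral_triangle (f := fun x y => (Kx x y : ℂ) * U y) hKxU)),
    fun x hx => ⟨?_, ?_⟩⟩
  · exact (hUd x hx).1.add (hasDerivAt_integral_triangle (f := fun x y => (K x y : ℂ) * U y)
      (f' := fun x y => (Kx x y : ℂ) * U y) hKU hKxU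
      (fun x y hy hyx hx => (hK.hasDerivAt_x x y hy hyx hx).ofReal_comp.mul_const _) hx)
  · obtain ⟨d, hd, hdiag⟩ := hK.diag x hx
    have hder := (hUd x hx).2.add ((hd.ofReal_comp.mul (hUd x hx).1).add
      (hasDerivAt_integral_triangle (f := fun x y => (Kx x y : ℂ) * U y)
        (f' := fun x y => (Kxx x y : ℂ) * U y) hKxU hKxxU
        (fun x y hy hyx hx => (hK.hasDerivAt_xx x y hy hyx hx).ofReal_comp.mul_const _) hx))
    refine hder.congr_deriv ?_
    have hxI := Ioo_subset_Icc_self hx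
    have hne : ∀ y ∈ Icc 0 ℓ, (a y : ℂ) ≠ 0 := fun y hy =>
      Complex.ofReal_ne_zero.2 (hapos y hy).ne'
    have hsub : Icc 0 x ⊆ Icc 0 ℓ := Icc_subset_Icc_right hx.2.le
    have hii : ∀ {f : ℝ → ℝ → ℂ}, ContinuousOn (fun z : ℝ × ℝ => f z.1 z.2) (triangle ℓ) →
        IntervalIntegrable (f x) volume 0 x := fun hf =>
      (continuousOn_triangle_slice hf hx.2.le).intervalIntegrable_of_Icc hx.1.le
    have iKU := hii (f := fun x y => (K x y : ℂ) * U y) hKU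
    have iKF := hii (f := fun x y => (K x y : ℂ) * F y) hKF
    have iKxxU := hii (f := fun x y => (Kxx x y : ℂ) * U y) hKxxU
    have hftc := integral_eq_sub_of_hasDerivAt_of_le hx.1.le
      (f := fun y => (L x y : ℂ) * U y - ((a y * K x y : ℝ) : ℂ) * U₁ y)
      (f' := fun y => a x * (Kxx x y * U y) - (q x + κ) * (K x y * U y) - K x y * F y)
      (((Complex.continuous_ofReal.comp_continuousOn
          (continuousOn_triangle_slice hK.continuousOn_L hx.2.le)).mul (hUc.mono hsub)).sub
        ((Complex.continuous_ofReal.comp_continuousOn ((ha.mono hsub).mul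
          (continuousOn_triangle_slice hK.continuousOn hx.2.le))).mul (hU₁c.mono hsub)))
      (fun y hy => by
        have hyI : y ∈ Ioo 0 ℓ := ⟨hy.1, hy.2.trans hx.2⟩
        have h := ((hK.hasDerivAt_L x y hy.1 hy.2 hx.2).ofReal_comp.mul (hUd y hyI).1).sub
          ((hK.hasDerivAt_mul x y hy.1 hy.2 hx.2).ofReal_comp.mul (hUd y hyI).2)
        refine h.congr_deriv ?_
        have := hne y (Ioo_subset_Icc_self hyI)
        push_cast
        field_simp
        ring)
      (((iKxxU.const_mul _).sub (iKU.const_mul _)).sub iKF)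
    rw [intervalIntegral.integral_sub ((iKxxU.const_mul _).sub (iKU.const_mul _)) iKF,
      intervalIntegral.integral_sub (iKxxU.const_mul _) (iKU.const_mul _),
      intervalIntegral.integral_const_mul, intervalIntegral.integral_const_mul,
      hK.bottom x hx, hU₁] at hftc
    have hdiag' : (a x * d + a x * Kx x x + L x x : ℂ) = q x - p x := by exact_mod_cast hdiag
    have := hne x hxI
    push_cast at hftc
    field_simp
    linear_combination hftc + U x * hdiag'

end Kernel

section Uniqueness

variable {ℓ T : ℝ} {a q : ℝ → ℝ}

theorem volterra_eq_of_hasDerivAt (hℓ : 0 ≤ ℓ) {f f' : ℝ → ℂ} (hf : ContinuousOn f (Icc 0 ℓ))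
    (hf' : ContinuousOn f' (Icc 0 ℓ)) (hd : ∀ x ∈ Ioo 0 ℓ, HasDerivAt f (f' x) x) (h0 : f 0 = 0)
    {φ : C(Icc 0 ℓ, ℂ)} (hφ : ∀ y (hy : y ∈ Icc 0 ℓ), φ ⟨y, hy⟩ = f' y) :
    volterra hℓ φ = ⟨_, hf.domRestrict⟩ := by
  ext x
  have hsub : Icc 0 (x : ℝ) ⊆ Icc 0 ℓ := Icc_subset_Icc_right x.2.2
  rw [volterra_apply_of_eqOn hℓ hφ, integral_eq_sub_of_hasDerivAt_of_le x.2.1 (hf.mono hsub)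
    (fun y hy => hd y ⟨hy.1, hy.2.trans_le x.2.2⟩)
    ((hf'.mono hsub).intervalIntegrable_of_Icc x.2.1), h0, sub_zero]
  rfl

/-- If the Cauchy problems `a Z'' = (q + σz) Z + σ (e^{-zT} g_T - g₀)`, `Z(0) = Z'(0) = 0` have
solutions bounded uniformly in the right half-plane of the parameter `z`, then `g₀ = 0`. -/
theorem eq_zero_of_isODESol_family_bounded (hℓ : 0 < ℓ) (hT : 0 < T) {σ : ℂ} (hσ : σ ≠ 0)
    (ha : ContinuousOn a (Icc 0 ℓ)) (hapos : ∀ x ∈ Icc 0 ℓ, 0 < a x)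
    (hq : ContinuousOn q (Icc 0 ℓ)) {g₀ gT : ℝ → ℂ} (hg₀ : ContinuousOn g₀ (Icc 0 ℓ))
    (hgT : ContinuousOn gT (Icc 0 ℓ)) {Z Z₁ : ℂ → ℝ → ℂ}
    (hZ : ∀ z, IsODESol ℓ a q (σ * z) (fun x => σ * (Complex.exp (-z * T) * gT x - g₀ x))
      (Z z) (Z₁ z))
    (hZ0 : ∀ z, Z z 0 = 0) (hZ₁0 : ∀ z, Z₁ z 0 = 0) {M : ℝ}
    (hM : ∀ z : ℂ, 0 ≤ z.re → ∀ x ∈ Icc 0 ℓ, ‖Z z x‖ ≤ M) : ∀ x ∈ Icc 0 ℓ, g₀ x = 0 := by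
  have hne : ∀ y ∈ Icc 0 ℓ, (a y : ℂ) ≠ 0 := fun y hy => Complex.ofReal_ne_zero.2 (hapos y hy).ne'
  have haC : ContinuousOn (fun x => (a x : ℂ)) (Icc 0 ℓ) :=
    Complex.continuous_ofReal.comp_continuousOn ha
  have hqC : ContinuousOn (fun x => (q x : ℂ)) (Icc 0 ℓ) :=
    Complex.continuous_ofReal.comp_continuousOn hq
  have hc₀ : ContinuousOn (fun x => (q x / a x : ℂ)) (Icc 0 ℓ) := hqC.div haC hne
  have hc₁ : ContinuousOn (fun x => (σ / a x : ℂ)) (Icc 0 ℓ) := continuousOn_const.div haC hne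
  have key := eq_zero_of_volterraSq_family_bounded hℓ hT (c₀ := ⟨_, hc₀.domRestrict⟩)
    (c₁ := ⟨_, hc₁.domRestrict⟩) (g₀ := ⟨_, hg₀.domRestrict⟩) (gT := ⟨_, hgT.domRestrict⟩)
    (M := M) (Z := fun z => ⟨_, (hZ z).1.domRestrict⟩)
    (fun x => div_ne_zero hσ (hne x x.2)) (fun z => ?_) (fun z hz => ?_)
  · exact fun x hx => DFunLike.congr_fun key ⟨x, hx⟩
  · obtain ⟨hZc, hZ₁c, hZd⟩ := hZ z
    rw [volterraSq_apply, volterraSq_apply, ← map_add, ← map_add]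
    refine Eq.symm ((congrArg (volterra hℓ.le) (volterra_eq_of_hasDerivAt hℓ.le hZ₁c (f' := fun x =>
      ((q x + σ * z) * Z z x + σ * (Complex.exp (-z * T) * gT x - g₀ x)) / a x)
      ((((hqC.add continuousOn_const).mul hZc).add (continuousOn_const.mul
        ((continuousOn_const.mul hgT).sub hg₀))).div haC hne) (fun x hx => (hZd x hx).2) (hZ₁0 z)
      fun y hy => ?_)).trans (volterra_eq_of_hasDerivAt hℓ.le hZc hZ₁c (fun x hx => (hZd x hx).1)
        (hZ0 z) fun _ _ => rfl))
    change (q y / a y + z * (σ / a y)) * Z z y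
      + σ / a y * (Complex.exp (-z * T) * gT y - g₀ y) = _
    ring
  · have hM0 : 0 ≤ M := (norm_nonneg _).trans (hM z hz 0 (left_mem_Icc.2 hℓ.le))
    exact (ContinuousMap.norm_le _ hM0).2 fun x => hM z hz x x.2

end Uniqueness

theorem integral_congr_Ioo {a b : ℝ} (hab : a ≤ b) {f g : ℝ → ℂ} (h : ∀ t ∈ Ioo a b, f t = g t) :
    ∫ t in a..b, f t = ∫ t in a..b, g t := by
  rw [integral_of_le hab, integral_of_le hab, integral_Ioc_eq_integral_Ioo,
    integral_Ioc_eq_integral_Ioo]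
  exact setIntegral_congr_fun measurableSet_Ioo h

theorem norm_laplace_le {T M : ℝ} (hT : 0 ≤ T) {f : ℝ → ℂ} (hM : ∀ t ∈ Icc 0 T, ‖f t‖ ≤ M) {z : ℂ}
    (hz : 0 ≤ z.re) : ‖∫ t in (0:ℝ)..T, Complex.exp (-z * t) * f t‖ ≤ M * T := by
  have h := norm_integral_le_of_norm_le_const (a := 0) (b := T) (C := M)
    (f := fun t : ℝ => Complex.exp (-z * t) * f t) fun t ht => by
      rw [uIoc_of_le hT] at ht
      have h1 : ‖Complex.exp (-z * t)‖ ≤ 1 := by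
        rw [Complex.norm_exp, Real.exp_le_one_iff]
        simpa using mul_nonneg hz ht.1.le
      rw [norm_mul]
      exact (mul_le_of_le_one_left (norm_nonneg _) h1).trans (hM t (Ioc_subset_Icc_self ht))
  rwa [sub_zero, abs_of_nonneg hT] at h

theorem norm_add_integral_kernel_le {ℓ C M : ℝ} {K : ℝ → ℝ → ℝ} {U : ℝ → ℂ} (hC : 0 ≤ C)
    (hK : ∀ z ∈ triangle ℓ, ‖K z.1 z.2‖ ≤ C) (hU : ∀ x ∈ Icc 0 ℓ, ‖U x‖ ≤ M) {x : ℝ}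
    (hx : x ∈ Icc 0 ℓ) : ‖U x + ∫ y in (0:ℝ)..x, K x y * U y‖ ≤ M + C * M * ℓ := by
  have hM : 0 ≤ M := (norm_nonneg _).trans (hU x hx)
  have h := norm_integral_le_of_norm_le_const (a := 0) (b := x) (C := C * M)
    (f := fun y => (K x y : ℂ) * U y) fun y hy => by
      rw [uIoc_of_le hx.1] at hy
      rw [norm_mul, Complex.norm_real]
      exact mul_le_mul (hK (x, y) ⟨hy.1.le, hy.2, hx.2⟩) (hU y ⟨hy.1.le, hy.2.trans hx.2⟩)
        (norm_nonneg _) hC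
  rw [sub_zero, abs_of_nonneg hx.1] at h
  exact (norm_add_le _ _).trans (add_le_add (hU x hx) (h.trans (by gcongr; exact hx.2)))

/-- From equal lateral Cauchy data at `x = 0` (with zero Neumann data) and a
common initial value `b`, the transformation kernel `K` annihilates `b`:
`∫₀ˣ K(x,y)b(y)dy = 0` on `[0,ℓ]` (identity (2.10)). -/
theorem stmt_13
    (T ℓ : ℝ) (hT : 0 < T) (hℓ : 0 < ℓ)
    (σ : ℂ) (hσ : σ ≠ 0)
    (p q a : ℝ → ℝ)
    (hp : ContDiffOn ℝ 1 p (Icc 0 ℓ)) (hq : ContDiffOn ℝ 1 q (Icc 0 ℓ))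
    (ha : ContDiffOn ℝ 2 a (Icc 0 ℓ)) (hapos : ∀ x ∈ Icc (0:ℝ) ℓ, 0 < a x)
    (K : ℝ → ℝ → ℝ) (hK : IsGoursatSol ℓ a p q K)
    (b : ℝ → ℂ) (hb : ContinuousOn b (Icc 0 ℓ))
    (u ut ux uxx v vt vx vxx : ℝ → ℝ → ℂ)
    (hu : IsC12 T ℓ u ut ux uxx) (hv : IsC12 T ℓ v vt vx vxx)
    (hupde : ∀ t ∈ Ioo (0:ℝ) T, ∀ x ∈ Ioo (0:ℝ) ℓ,
      σ * ut t x = a x * uxx t x - p x * u t x)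
    (hvpde : ∀ t ∈ Ioo (0:ℝ) T, ∀ x ∈ Ioo (0:ℝ) ℓ,
      σ * vt t x = a x * vxx t x - q x * v t x)
    (hinit : ∀ x ∈ Ioo (0:ℝ) ℓ, u 0 x = b x ∧ v 0 x = b x)
    (hdir : ∀ t ∈ Ioo (0:ℝ) T, u t 0 = v t 0)
    (hneu : ∀ t ∈ Ioo (0:ℝ) T, ux t 0 = 0 ∧ vx t 0 = 0) :
    ∀ x ∈ Icc (0:ℝ) ℓ, (∫ y in (0:ℝ)..x, (K x y : ℂ) * b y) = 0 := by
  obtain ⟨Kx, Kxx, L, hKt⟩ := hK.exists_isTransmutationKernel hℓ ha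
  have hK00 : K 0 0 = 0 := hK.2.2.2.2
  have slice : ∀ {w wt wx wxx : ℝ → ℝ → ℂ}, IsC12 T ℓ w wt wx wxx → ∀ t ∈ Icc 0 T,
      ContinuousOn (w t) (Icc 0 ℓ) := fun hw t ht x hx => (hw.1 t ht x hx).2.1.continuousWithinAt
  have h0 : (0:ℝ) ∈ Icc 0 T := left_mem_Icc.2 hT.le
  have hT' : T ∈ Icc 0 T := right_mem_Icc.2 hT.le
  have hKc : ∀ {f : ℝ → ℂ}, ContinuousOn f (Icc 0 ℓ) →
      ContinuousOn (fun x => ∫ y in (0:ℝ)..x, (K x y : ℂ) * f y) (Icc 0 ℓ) := fun {f} hf =>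
    continuousOn_integral_triangle (f := fun x y => (K x y : ℂ) * f y)
      (continuousOn_ofReal_mul_triangle hKt.continuousOn hf)
  set g : ℝ → ℝ → ℂ := fun t x => u t x + (∫ y in (0:ℝ)..x, (K x y : ℂ) * u t y) - v t x with hg
  have hgc : ∀ t ∈ Icc 0 T, ContinuousOn (g t) (Icc 0 ℓ) := fun t ht =>
    ((slice hu t ht).add (hKc (slice hu t ht))).sub (slice hv t ht)
  set U : ℂ → ℝ → ℂ := fun z x => ∫ t in (0:ℝ)..T, Complex.exp (-z * t) * u t x
  set U₁ : ℂ → ℝ → ℂ := fun z x => ∫ t in (0:ℝ)..T, Complex.exp (-z * t) * ux t x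
  set V : ℂ → ℝ → ℂ := fun z x => ∫ t in (0:ℝ)..T, Complex.exp (-z * t) * v t x
  set V₁ : ℂ → ℝ → ℂ := fun z x => ∫ t in (0:ℝ)..T, Complex.exp (-z * t) * vx t x
  have hUV : ∀ z, U z 0 = V z 0 := fun z =>
    integral_congr_Ioo hT.le fun t ht => by rw [hdir t ht]
  have hU₁ : ∀ z, U₁ z 0 = 0 := fun z =>
    (integral_congr_Ioo hT.le fun t ht => by rw [(hneu t ht).1, mul_zero]).trans integral_zero
  have hV₁ : ∀ z, V₁ z 0 = 0 := fun z =>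
    (integral_congr_Ioo hT.le fun t ht => by rw [(hneu t ht).2, mul_zero]).trans integral_zero
  obtain ⟨Mu, hMu⟩ := (isCompact_Icc.prod isCompact_Icc).exists_bound_of_continuousOn hu.2.1
  obtain ⟨Mv, hMv⟩ := (isCompact_Icc.prod isCompact_Icc).exists_bound_of_continuousOn hv.2.1
  obtain ⟨C, hC⟩ := isCompact_triangle.exists_bound_of_continuousOn hKt.continuousOn
  have hC0 : 0 ≤ C := (norm_nonneg _).trans (hC (0, 0) ⟨le_rfl, le_rfl, hℓ.le⟩)
  have hg0 : ∀ x ∈ Icc 0 ℓ, g 0 x = 0 := by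
    refine eq_zero_of_isODESol_family_bounded hℓ hT hσ ha.continuousOn hapos hq.continuousOn
      (hgc 0 h0) (hgc T hT')
      (Z := fun z x => U z x + (∫ y in (0:ℝ)..x, K x y * U z y) - V z x)
      (Z₁ := fun z x => U₁ z x + (K x x * U z x + ∫ y in (0:ℝ)..x, Kx x y * U z y) - V₁ z x)
      (M := Mu * T + C * (Mu * T) * ℓ + Mv * T) (fun z => ?_) (fun z => ?_) (fun z => ?_)
      fun z hz x hx => ?_
    · have hF : ContinuousOn (fun x => σ * (Complex.exp (-z * T) * u T x - u 0 x)) (Icc 0 ℓ) :=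
        continuousOn_const.mul ((continuousOn_const.mul (slice hu T hT')).sub (slice hu 0 h0))
      have h := ((hu.isODESol_laplace hT hapos hupde z).transmute ha.continuousOn hapos hKt hF
        (hU₁ z)).sub (hv.isODESol_laplace hT hapos hvpde z)
      refine ⟨h.1, h.2.1, fun x hx => ⟨(h.2.2 x hx).1, (h.2.2 x hx).2.congr_deriv ?_⟩⟩
      have hi : ∀ t ∈ Icc 0 T, IntervalIntegrable (fun y => (K x y : ℂ) * u t y) volume 0 x :=
        fun t ht => (continuousOn_triangle_slice (f := fun x y => (K x y : ℂ) * u t y)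
          (continuousOn_ofReal_mul_triangle hKt.continuousOn (slice hu t ht))
          hx.2.le).intervalIntegrable_of_Icc hx.1.le
      have hint : ∫ y in (0:ℝ)..x, (K x y : ℂ) * (σ * (Complex.exp (-z * T) * u T y - u 0 y))
          = σ * (Complex.exp (-z * T) * (∫ y in (0:ℝ)..x, (K x y : ℂ) * u T y)
            - ∫ y in (0:ℝ)..x, (K x y : ℂ) * u 0 y) := by
        rw [← intervalIntegral.integral_const_mul, ← intervalIntegral.integral_sub
          ((hi T hT').const_mul _) (hi 0 h0), ← intervalIntegral.integral_const_mul]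
        exact integral_congr fun y _ => by ring
      simp only [hint, hg]
      ring
    · simp [hUV z]
    · simp [hU₁ z, hV₁ z, hK00]
    · exact (norm_sub_le _ _).trans (add_le_add (norm_add_integral_kernel_le hC0 hC
        (fun y hy => norm_laplace_le hT.le (fun t ht => hMu (t, y) ⟨ht, hy⟩) hz) hx)
        (norm_laplace_le hT.le (fun t ht => hMv (t, x) ⟨ht, hx⟩) hz))
  have hclos : Icc 0 ℓ ⊆ closure (Ioo 0 ℓ) := (closure_Ioo hℓ.ne).ge
  have hub : EqOn (u 0) b (Icc 0 ℓ) := EqOn.of_subset_closure (fun x hx => (hinit x hx).1)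
    (slice hu 0 h0) hb Ioo_subset_Icc_self hclos
  have hvb : EqOn (v 0) b (Icc 0 ℓ) := EqOn.of_subset_closure (fun x hx => (hinit x hx).2)
    (slice hv 0 h0) hb Ioo_subset_Icc_self hclos
  intro x hx
  have h := hg0 x hx
  simp only [hg, hub hx, hvb hx, add_sub_cancel_left] at h
  rw [← h]
  refine integral_congr fun y hy => ?_
  rw [uIcc_of_le hx.1] at hy
  exact congrArg _ (hub ⟨hy.1, hy.2.trans hx.2⟩).symm
end
end
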